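/- Let n ≥ 2, α ∈ ℝ, 0 < s < p < ∞, and q⃗ = (q_1,…,q_n) with s < q_i < ∞ for each i, such that −Σ_{i=1}^n 1/q_i < α < n/s − Σ_{i=1}^n 1/q_i. Let T be a map from measurable functions to measurable functions such that for every Λ ≥ 1 there is C(Λ) > 0 with ‖Tf‖_{L^s_w} ≤ C(Λ)‖f‖_{L^s_w} for every w ∈ A_1(ℝⁿ) with [w]_{A_1} ≤ Λ and every f ∈ L^s_w(ℝⁿ). Then there is C' > 0 such that ‖Tf‖_{K̇^{α,p}_{q⃗}} ≤ C'‖f‖_{K̇^{α,p}_{q⃗}} for every f ∈ K̇^{α,p}_{q⃗}(ℝⁿ). -/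

import Mathlib

open MeasureTheory ENNReal Set Filter
open scoped NNReal Topology

noncomputable section

/-- Euclidean space `ℝⁿ`. -/
abbrev Euc (n : ℕ) := EuclideanSpace ℝ (Fin n)

/-- The dyadic annulus `C_k = B(0,2^k) \ B(0,2^{k-1})`. -/
def annulus (n : ℕ) (k : ℤ) : Set (Euc n) :=
  Metric.ball (0 : Euc n) ((2 : ℝ) ^ k) \ Metric.ball (0 : Euc n) ((2 : ℝ) ^ (k - 1))

/-- The Hardy–Littlewood maximal operator, acting on nonnegative extended-real-valued
functions (representing `|f|`): `Mf(x) = sup_{B ∋ x} |B|⁻¹ ∫_B f`. -/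
def maximalFn {n : ℕ} (f : Euc n → ℝ≥0∞) (x : Euc n) : ℝ≥0∞ :=
  ⨆ (c : Euc n) (r : ℝ) (_ : 0 < r) (_ : x ∈ Metric.ball c r),
    (volume (Metric.ball c r))⁻¹ * ∫⁻ y in Metric.ball c r, f y ∂volume

/-- A ball Banach function space on `ℝⁿ`, encoded by its norm functional `N`,
defined on all nonnegative extended-real-valued measurable functions (a real measurable
function `f` has norm `N (fun x => ‖f x‖₊)`). -/
structure BallBFS (n : ℕ) where
  N : (Euc n → ℝ≥0∞) → ℝ≥0∞
  norm_zero_iff : ∀ f : Euc n → ℝ≥0∞, Measurable f → (N f = 0 ↔ f =ᵐ[volume] 0)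
  norm_mono : ∀ f g : Euc n → ℝ≥0∞, (∀ᵐ x ∂volume, g x ≤ f x) → N g ≤ N f
  norm_isup : ∀ f : ℕ → Euc n → ℝ≥0∞, (∀ m, ∀ᵐ x ∂volume, f m x ≤ f (m + 1) x) →
    N (fun x => ⨆ m, f m x) = ⨆ m, N (f m)
  ball_mem : ∀ (x : Euc n) (r : ℝ), 0 < r → N ((Metric.ball x r).indicator 1) < ∞
  norm_add : ∀ f g : Euc n → ℝ≥0∞, N (fun x => f x + g x) ≤ N f + N g
  ball_integral : ∀ (x : Euc n) (r : ℝ), 0 < r → ∃ C : ℝ≥0∞, 0 < C ∧ C < ∞ ∧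
    ∀ f : Euc n → ℝ≥0∞, N f < ∞ → ∫⁻ y in Metric.ball x r, f y ∂volume ≤ C * N f

/-- The associate ("Köthe dual") norm of a norm functional `N`:
`‖g‖_{X'} = sup { ∫ f·g : ‖f‖_X ≤ 1 }`. -/
def assocN {n : ℕ} (N : (Euc n → ℝ≥0∞) → ℝ≥0∞) (g : Euc n → ℝ≥0∞) : ℝ≥0∞ :=
  ⨆ (f : Euc n → ℝ≥0∞) (_ : Measurable f) (_ : N f ≤ 1), ∫⁻ x, f x * g x ∂volume

/-- The homogeneous Herz-type quasinorm associated with a norm functional `N`,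
for a finite exponent `0 < p < ∞`:
`‖f‖ = (Σ_{k∈ℤ} 2^{kpα} ‖f χ_k‖_X ^ p)^{1/p}`. -/
def herzNorm {n : ℕ} (N : (Euc n → ℝ≥0∞) → ℝ≥0∞) (α p : ℝ) (f : Euc n → ℝ≥0∞) : ℝ≥0∞ :=
  (∑' k : ℤ, (2 : ℝ≥0∞) ^ ((k : ℝ) * p * α) * (N ((annulus n k).indicator f)) ^ p) ^ (1 / p)

/-- The homogeneous Herz-type quasinorm, with exponent `p ∈ (0,∞]`
(for `p = ∞` the sum is replaced by a supremum). -/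
def herzNormE {n : ℕ} (N : (Euc n → ℝ≥0∞) → ℝ≥0∞) (α : ℝ) (p : ℝ≥0∞)
    (f : Euc n → ℝ≥0∞) : ℝ≥0∞ :=
  if p = ∞ then ⨆ k : ℤ, (2 : ℝ≥0∞) ^ ((k : ℝ) * α) * N ((annulus n k).indicator f)
  else herzNorm N α p.toReal f

/-- The iterated mixed-norm functional on `Fin m → ℝ`: one takes the `L^{q 0}` norm in the
first variable, then the `L^{q 1}` norm in the second variable, and so on. -/
def mixedNormAux : (m : ℕ) → (Fin m → ℝ) → ((Fin m → ℝ) → ℝ≥0∞) → ℝ≥0∞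
  | 0, _, f => f ![]
  | m + 1, q, f => mixedNormAux m (fun i => q i.succ)
      (fun x => (∫⁻ t : ℝ, f (Fin.cons t x) ^ q 0 ∂volume) ^ (1 / q 0))

/-- The mixed-norm Lebesgue quasinorm `‖f‖_{L^{q⃗}}` on `ℝⁿ`, applied to nonnegative
extended-real-valued `f` (representing `|f|`). -/
def mixedNorm {n : ℕ} (q : Fin n → ℝ) (f : Euc n → ℝ≥0∞) : ℝ≥0∞ :=
  mixedNormAux n q (fun x => f ((EuclideanSpace.equiv (Fin n) ℝ).symm x))

/-- The Herz quasinorm of a real-valued function (finite exponent `p`). -/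
def herzR {n : ℕ} (N : (Euc n → ℝ≥0∞) → ℝ≥0∞) (α p : ℝ) (f : Euc n → ℝ) : ℝ≥0∞ :=
  herzNorm N α p (fun x => (‖f x‖₊ : ℝ≥0∞))

/-- The weighted Lebesgue quasinorm `‖f‖_{L^s_w} = (∫ |f|^s w)^{1/s}`. -/
def wLpNorm {n : ℕ} (s : ℝ) (w : Euc n → ℝ≥0∞) (f : Euc n → ℝ) : ℝ≥0∞ :=
  (∫⁻ x, (‖f x‖₊ : ℝ≥0∞) ^ s * w x ∂volume) ^ (1 / s)

/-- The Muckenhoupt `A₁` condition with constant (at most) `Λ`. -/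
def IsA1 {n : ℕ} (Λ : ℝ≥0∞) (w : Euc n → ℝ≥0∞) : Prop :=
  Measurable w ∧ (∀ᵐ x ∂volume, 0 < w x ∧ w x < ∞) ∧
    (∀ (x : Euc n) (r : ℝ), 0 < r → ∫⁻ y in Metric.ball x r, w y ∂volume < ∞) ∧
    ∀ᵐ x ∂volume, maximalFn w x ≤ Λ * w x

/-- Two functionals on nonnegative functions which are Köthe dual to each other: Hölder's
inequality holds, and the first one is the supremum of the pairings against the unit ball of the
second one. -/
structure IsKotheDual {Ω : Type*} [MeasurableSpace Ω] (μ : Measure Ω)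
    (N N' : (Ω → ℝ≥0∞) → ℝ≥0∞) : Prop where
  holder : ∀ f g : Ω → ℝ≥0∞, Measurable f → Measurable g →
    ∫⁻ x, f x * g x ∂μ ≤ N f * N' g
  norming : ∀ f : Ω → ℝ≥0∞, Measurable f → ∀ c < N f,
    ∃ g : Ω → ℝ≥0∞, Measurable g ∧ N' g ≤ 1 ∧ c < ∫⁻ x, f x * g x ∂μ

namespace IsKotheDual

variable {Ω : Type*} [MeasurableSpace Ω] {μ : Measure Ω} {N N' : (Ω → ℝ≥0∞) → ℝ≥0∞}

theorem le_of_forall_lintegral_le (h : IsKotheDual μ N N') {f : Ω → ℝ≥0∞} (hf : Measurable f)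
    {B : ℝ≥0∞} (hB : ∀ g : Ω → ℝ≥0∞, Measurable g → N' g ≤ 1 → ∫⁻ x, f x * g x ∂μ ≤ B) :
    N f ≤ B := by
  by_contra! hlt
  obtain ⟨g, hg, hg1, hc⟩ := h.norming f hf B hlt
  exact absurd (hB g hg hg1) (not_le.2 hc)

theorem lintegral_le (h : IsKotheDual μ N N') {f g : Ω → ℝ≥0∞} (hf : Measurable f)
    (hg : Measurable g) (hg1 : N' g ≤ 1) : ∫⁻ x, f x * g x ∂μ ≤ N f :=
  (h.holder f g hf hg).trans (mul_le_of_le_one_right' hg1)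

theorem mono_ae (h : IsKotheDual μ N N') {f g : Ω → ℝ≥0∞} (hf : Measurable f) (hg : Measurable g)
    (hfg : ∀ᵐ x ∂μ, f x ≤ g x) : N f ≤ N g := by
  refine h.le_of_forall_lintegral_le hf fun k hk hk1 => ?_
  refine le_trans (lintegral_mono_ae ?_) (h.lintegral_le hg hk hk1)
  filter_upwards [hfg] with x hx
  gcongr

theorem mono (h : IsKotheDual μ N N') {f g : Ω → ℝ≥0∞} (hf : Measurable f) (hg : Measurable g)
    (hfg : ∀ x, f x ≤ g x) : N f ≤ N g :=
  h.mono_ae hf hg (Eventually.of_forall hfg)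

theorem const_mul_le (h : IsKotheDual μ N N') (c : ℝ≥0∞) {f : Ω → ℝ≥0∞} (hf : Measurable f) :
    N (fun x => c * f x) ≤ c * N f := by
  refine h.le_of_forall_lintegral_le (hf.const_mul c) fun k hk hk1 => ?_
  simp_rw [mul_assoc]
  rw [lintegral_const_mul _ (by fun_prop)]
  gcongr
  exact h.lintegral_le hf hk hk1

theorem tsum_le (h : IsKotheDual μ N N') {ι : Type*} [Countable ι] {F : ι → Ω → ℝ≥0∞}
    (hF : ∀ i, Measurable (F i)) : N (fun x => ∑' i, F i x) ≤ ∑' i, N (F i) := by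
  refine h.le_of_forall_lintegral_le (Measurable.tsum hF) fun k hk hk1 => ?_
  simp_rw [← ENNReal.tsum_mul_right]
  rw [lintegral_tsum fun i => ((hF i).fun_mul hk).aemeasurable]
  exact ENNReal.tsum_le_tsum fun i => h.lintegral_le (hF i) hk hk1

theorem add_le (h : IsKotheDual μ N N') {f g : Ω → ℝ≥0∞} (hf : Measurable f)
    (hg : Measurable g) : N (fun x => f x + g x) ≤ N f + N g := by
  refine h.le_of_forall_lintegral_le (hf.fun_add hg) fun k hk hk1 => ?_
  simp_rw [add_mul]
  rw [lintegral_add_left (hf.fun_mul hk)]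
  exact add_le_add (h.lintegral_le hf hk hk1) (h.lintegral_le hg hk hk1)

theorem zero (h : IsKotheDual μ N N') : N (fun _ => 0) = 0 := by
  refine le_antisymm (h.le_of_forall_lintegral_le measurable_const fun k _ _ => ?_) zero_le
  simp

theorem ae_lt_top (h : IsKotheDual μ N N') {f φ : Ω → ℝ≥0∞} (hf : Measurable f)
    (hφ : Measurable φ) (hφ0 : ∀ x, 0 < φ x) (hφN : N' φ ≠ ∞) (hfN : N f ≠ ∞) :
    ∀ᵐ x ∂μ, f x < ∞ := by
  have h1 : ∫⁻ x, f x * φ x ∂μ ≠ ∞ :=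
    ((h.holder f φ hf hφ).trans_lt (ENNReal.mul_lt_top hfN.lt_top hφN.lt_top)).ne
  filter_upwards [MeasureTheory.ae_lt_top (hf.fun_mul hφ) h1] with x hx
  by_contra! hfx
  rw [top_le_iff.1 hfx, ENNReal.top_mul (hφ0 x).ne'] at hx
  exact lt_irrefl _ hx

/-- A strictly positive function of finite norm, built from a countable cover by sets whose
indicators have finite norm. -/
theorem exists_pos (h : IsKotheDual μ N N') {ι : Type*} [Countable ι] {E : ι → Set Ω}
    (hE : ∀ i, MeasurableSet (E i)) (hcov : ∀ x, ∃ i, x ∈ E i)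
    (hEN : ∀ i, N ((E i).indicator 1) ≠ ∞) :
    ∃ φ : Ω → ℝ≥0∞, Measurable φ ∧ (∀ x, 0 < φ x) ∧ N φ ≤ 1 := by
  obtain ⟨ε, hε0, hε⟩ := ENNReal.exists_pos_tsum_mul_lt_of_countable (ε := 1) one_ne_zero
    (fun i => N ((E i).indicator 1)) hEN
  have hm : ∀ i, Measurable fun x => (ε i : ℝ≥0∞) * (E i).indicator (1 : Ω → ℝ≥0∞) x := fun i =>
    (measurable_one.indicator (hE i)).const_mul _
  refine ⟨fun x => ∑' i, (ε i : ℝ≥0∞) * (E i).indicator 1 x, Measurable.tsum hm, fun x => ?_, ?_⟩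
  · obtain ⟨i, hi⟩ := hcov x
    refine lt_of_lt_of_le ?_ (ENNReal.le_tsum i)
    simp [hi, hε0 i]
  · refine (h.tsum_le hm).trans (le_trans (ENNReal.tsum_le_tsum fun i => ?_) hε.le)
    rw [mul_comm (N _)]
    exact h.const_mul_le _ (measurable_one.indicator (hE i))

end IsKotheDual

/-- The properties of a maximal operator that make the Rubio de Francia algorithm work. -/
structure IsSublinear {Ω : Type*} [MeasurableSpace Ω] (M : (Ω → ℝ≥0∞) → Ω → ℝ≥0∞) : Prop where
  measurable : ∀ f, Measurable f → Measurable (M f)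
  tsum_le : ∀ F : ℕ → Ω → ℝ≥0∞, (∀ k, Measurable (F k)) → ∀ x,
    M (fun y => ∑' k, F k y) x ≤ ∑' k, M (F k) x
  const_mul_le : ∀ (c : ℝ≥0∞) (f : Ω → ℝ≥0∞), Measurable f → ∀ x,
    M (fun y => c * f y) x ≤ c * M f x

/-- The Rubio de Francia iteration of an operator. -/
def rubioDeFrancia {Ω : Type*} (M : (Ω → ℝ≥0∞) → Ω → ℝ≥0∞) (A : ℝ≥0∞) (g : Ω → ℝ≥0∞) :
    Ω → ℝ≥0∞ :=
  fun x => ∑' k : ℕ, (2 * A)⁻¹ ^ k * (M^[k] g) x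

theorem le_rubioDeFrancia {Ω : Type*} (M : (Ω → ℝ≥0∞) → Ω → ℝ≥0∞) (A : ℝ≥0∞)
    (g : Ω → ℝ≥0∞) (x : Ω) : g x ≤ rubioDeFrancia M A g x := by
  simpa [rubioDeFrancia] using ENNReal.le_tsum (f := fun k : ℕ => (2 * A)⁻¹ ^ k * (M^[k] g) x) 0

namespace IsSublinear

variable {Ω : Type*} [MeasurableSpace Ω] {M : (Ω → ℝ≥0∞) → Ω → ℝ≥0∞} {A : ℝ≥0∞}

theorem measurable_iterate (hM : IsSublinear M) {g : Ω → ℝ≥0∞} (hg : Measurable g) (k : ℕ) :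
    Measurable (M^[k] g) := by
  induction k with
  | zero => exact hg
  | succ k ih =>
    rw [Function.iterate_succ_apply']
    exact hM.measurable _ ih

theorem measurable_rubioDeFrancia (hM : IsSublinear M) {g : Ω → ℝ≥0∞} (hg : Measurable g) :
    Measurable (rubioDeFrancia M A g) :=
  Measurable.tsum fun k => (hM.measurable_iterate hg k).const_mul _

theorem apply_rubioDeFrancia_le (hM : IsSublinear M) (hA0 : A ≠ 0) (hA : A ≠ ∞)
    {g : Ω → ℝ≥0∞} (hg : Measurable g) (x : Ω) :
    M (rubioDeFrancia M A g) x ≤ 2 * A * rubioDeFrancia M A g x := by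
  have h2 : (2 * A) ≠ 0 := mul_ne_zero two_ne_zero hA0
  have h3 : (2 * A) ≠ ∞ := ENNReal.mul_ne_top ENNReal.ofNat_ne_top hA
  calc M (rubioDeFrancia M A g) x
      ≤ ∑' k, M (fun y => (2 * A)⁻¹ ^ k * (M^[k] g) y) x :=
        hM.tsum_le _ (fun k => (hM.measurable_iterate hg k).const_mul _) x
    _ ≤ ∑' k, 2 * A * ((2 * A)⁻¹ ^ (k + 1) * (M^[k + 1] g) x) := by
        refine ENNReal.tsum_le_tsum fun k => ?_
        refine (hM.const_mul_le _ _ (hM.measurable_iterate hg k) x).trans (le_of_eq ?_)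
        rw [Function.iterate_succ_apply', pow_succ', ← mul_assoc, ← mul_assoc,
          ENNReal.mul_inv_cancel h2 h3, one_mul]
    _ = 2 * A * ∑' k, (2 * A)⁻¹ ^ (k + 1) * (M^[k + 1] g) x := ENNReal.tsum_mul_left
    _ ≤ 2 * A * rubioDeFrancia M A g x := by
        gcongr
        exact ENNReal.tsum_comp_le_tsum_of_injective (add_left_injective 1)
          (fun k => (2 * A)⁻¹ ^ k * (M^[k] g) x)

theorem norm_rubioDeFrancia_le {μ : Measure Ω} {N N' : (Ω → ℝ≥0∞) → ℝ≥0∞}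
    (hM : IsSublinear M) (h : IsKotheDual μ N N') (hA0 : A ≠ 0) (hA : A ≠ ∞)
    (hMN : ∀ f, Measurable f → N (M f) ≤ A * N f) {g : Ω → ℝ≥0∞} (hg : Measurable g) :
    N (rubioDeFrancia M A g) ≤ 2 * N g := by
  have hk : ∀ k, N (M^[k] g) ≤ A ^ k * N g := by
    intro k
    induction k with
    | zero => simp
    | succ k ih =>
      rw [Function.iterate_succ_apply', pow_succ', mul_assoc]
      exact (hMN _ (hM.measurable_iterate hg k)).trans (by gcongr)
  calc N (rubioDeFrancia M A g)
      ≤ ∑' k, N (fun x => (2 * A)⁻¹ ^ k * (M^[k] g) x) :=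
        h.tsum_le fun k => (hM.measurable_iterate hg k).const_mul _
    _ ≤ ∑' k : ℕ, 2⁻¹ ^ k * N g := by
        refine ENNReal.tsum_le_tsum fun k => ?_
        refine (h.const_mul_le _ (hM.measurable_iterate hg k)).trans ?_
        refine (mul_le_mul_right (hk k) _).trans (le_of_eq ?_)
        rw [← mul_assoc, ← mul_pow, ENNReal.mul_inv (Or.inl two_ne_zero) (Or.inr hA0), mul_assoc,
          ENNReal.inv_mul_cancel hA0 hA, mul_one]
    _ = 2 * N g := by
        rw [ENNReal.tsum_mul_right, ENNReal.tsum_geometric, ENNReal.one_sub_inv_two, inv_inv]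

end IsSublinear

/-- The uncentered maximal operator of a measure on the line, over intervals with rational
endpoints. -/
def intervalMax (μ : Measure ℝ) (f : ℝ → ℝ≥0∞) (x : ℝ) : ℝ≥0∞ :=
  ⨆ I : ℚ × ℚ, (Ioo (I.1 : ℝ) I.2).indicator
    (fun _ => (μ (Ioo (I.1 : ℝ) I.2))⁻¹ * ∫⁻ t in Ioo (I.1 : ℝ) I.2, f t ∂μ) x

theorem average_le_intervalMax (μ : Measure ℝ) (f : ℝ → ℝ≥0∞) {x : ℝ} {I : ℚ × ℚ}
    (hx : x ∈ Ioo (I.1 : ℝ) I.2) :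
    (μ (Ioo (I.1 : ℝ) I.2))⁻¹ * ∫⁻ t in Ioo (I.1 : ℝ) I.2, f t ∂μ ≤ intervalMax μ f x := by
  have := le_iSup (fun I : ℚ × ℚ => (Ioo (I.1 : ℝ) I.2).indicator
    (fun _ => (μ (Ioo (I.1 : ℝ) I.2))⁻¹ * ∫⁻ t in Ioo (I.1 : ℝ) I.2, f t ∂μ) x) I
  simpa [intervalMax, indicator_of_mem hx] using this

theorem intervalMax_le {μ : Measure ℝ} {f : ℝ → ℝ≥0∞} {x : ℝ} {B : ℝ≥0∞}
    (h : ∀ I : ℚ × ℚ, x ∈ Ioo (I.1 : ℝ) I.2 →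
      (μ (Ioo (I.1 : ℝ) I.2))⁻¹ * ∫⁻ t in Ioo (I.1 : ℝ) I.2, f t ∂μ ≤ B) :
    intervalMax μ f x ≤ B := by
  refine iSup_le fun I => ?_
  by_cases hx : x ∈ Ioo (I.1 : ℝ) I.2
  · rw [indicator_of_mem hx]
    exact h I hx
  · simp [indicator_of_notMem hx]

theorem measurable_intervalMax (μ : Measure ℝ) (f : ℝ → ℝ≥0∞) : Measurable (intervalMax μ f) :=
  Measurable.iSup fun _ => measurable_const.indicator measurableSet_Ioo

/-- Every finite family of intervals has a subfamily with the same union and overlap at most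
two. -/
theorem exists_subfamily_overlap_le_two (s : Finset (ℚ × ℚ)) :
    ∃ s' ⊆ s, (⋃ I ∈ s, Ioo (I.1 : ℝ) I.2) ⊆ (⋃ I ∈ s', Ioo (I.1 : ℝ) I.2) ∧
      ∀ x : ℝ, (∑ I ∈ s', (Ioo (I.1 : ℝ) I.2).indicator (1 : ℝ → ℝ≥0∞) x) ≤ 2 := by
  classical
  obtain ⟨s', hs', hmin⟩ := Finset.exists_min_image
    (s.powerset.filter fun r => (⋃ I ∈ s, Ioo (I.1 : ℝ) I.2) ⊆ ⋃ I ∈ r, Ioo (I.1 : ℝ) I.2)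
    Finset.card ⟨s, by simp only [Finset.mem_filter, Finset.mem_powerset, subset_refl, true_and]⟩
  simp only [Finset.mem_filter, Finset.mem_powerset] at hs' hmin
  refine ⟨s', hs'.1, hs'.2, fun x => ?_⟩
  set T := s'.filter fun I => x ∈ Ioo (I.1 : ℝ) I.2 with hT
  have hsum : (∑ I ∈ s', (Ioo (I.1 : ℝ) I.2).indicator (1 : ℝ → ℝ≥0∞) x) = (T.card : ℝ≥0∞) := by
    simp [hT, indicator_apply, Finset.sum_boole]
  rw [hsum]
  by_contra! hcard
  have hcard' : 2 < T.card := by exact_mod_cast hcard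
  have hTne : T.Nonempty := Finset.card_pos.1 (by omega)
  obtain ⟨I, hI, hImin⟩ := Finset.exists_min_image T Prod.fst hTne
  obtain ⟨I', hI', hImax⟩ := Finset.exists_max_image T Prod.snd hTne
  obtain ⟨K, hK, hKI⟩ : ∃ K ∈ T, K ∉ ({I, I'} : Finset (ℚ × ℚ)) :=
    Finset.exists_mem_notMem_of_card_lt_card ((Finset.card_le_two).trans_lt hcard')
  simp only [Finset.mem_insert, Finset.mem_singleton, not_or] at hKI
  have hKs : K ∈ s' := (Finset.mem_filter.1 hK).1
  have hle := hmin (s'.erase K) ⟨(Finset.erase_subset _ _).trans hs'.1, ?_⟩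
  · rw [Finset.card_erase_of_mem hKs] at hle
    have := Finset.card_pos.2 ⟨K, hKs⟩
    omega
  · refine hs'.2.trans fun y hy => ?_
    simp only [mem_iUnion, exists_prop] at hy ⊢
    obtain ⟨L, hL, hyL⟩ := hy
    by_cases hLK : L = K
    · subst hLK
      have h1 := (Finset.mem_filter.1 hI)
      have h2 := (Finset.mem_filter.1 hI')
      have hm : (I.1 : ℝ) ≤ L.1 := by exact_mod_cast hImin L hK
      have hM : (L.2 : ℝ) ≤ I'.2 := by exact_mod_cast hImax L hK
      rcases le_total y x with hyx | hyx
      · exact ⟨I, Finset.mem_erase.2 ⟨fun h => hKI.1 h.symm, h1.1⟩,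
          hm.trans_lt hyL.1, hyx.trans_lt h1.2.2⟩
      · exact ⟨I', Finset.mem_erase.2 ⟨fun h => hKI.2 h.symm, h2.1⟩,
          h2.2.1.trans_le hyx, hyL.2.trans_le hM⟩
    · exact ⟨L, Finset.mem_erase.2 ⟨hLK, hL⟩, hyL⟩

theorem mul_measure_biUnion_le (μ : Measure ℝ) {f : ℝ → ℝ≥0∞} (hf : Measurable f) {c : ℝ≥0∞}
    (s : Finset (ℚ × ℚ))
    (hs : ∀ I ∈ s, c * μ (Ioo (I.1 : ℝ) I.2) ≤ ∫⁻ t in Ioo (I.1 : ℝ) I.2, f t ∂μ) :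
    c * μ (⋃ I ∈ s, Ioo (I.1 : ℝ) I.2) ≤ 2 * ∫⁻ t, f t ∂μ := by
  obtain ⟨s', hs', hU, h2⟩ := exists_subfamily_overlap_le_two s
  calc c * μ (⋃ I ∈ s, Ioo (I.1 : ℝ) I.2)
      ≤ c * ∑ I ∈ s', μ (Ioo (I.1 : ℝ) I.2) := by
        gcongr
        exact (measure_mono hU).trans (measure_biUnion_finset_le _ _)
    _ ≤ ∑ I ∈ s', ∫⁻ t in Ioo (I.1 : ℝ) I.2, f t ∂μ := by
        rw [Finset.mul_sum]
        exact Finset.sum_le_sum fun I hI => hs I (hs' hI)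
    _ = ∫⁻ t, (∑ I ∈ s', (Ioo (I.1 : ℝ) I.2).indicator (1 : ℝ → ℝ≥0∞) t) * f t ∂μ := by
        simp_rw [Finset.sum_mul]
        rw [lintegral_finsetSum _ fun I _ =>
          (measurable_one.indicator measurableSet_Ioo).fun_mul hf]
        refine Finset.sum_congr rfl fun I _ => ?_
        rw [← lintegral_indicator measurableSet_Ioo]
        congr with t
        by_cases ht : t ∈ Ioo (I.1 : ℝ) I.2 <;> simp [indicator, ht]
    _ ≤ ∫⁻ t, 2 * f t ∂μ := lintegral_mono fun t => by gcongr; exact h2 t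
    _ = 2 * ∫⁻ t, f t ∂μ := lintegral_const_mul _ hf

theorem mul_measure_lt_intervalMax_le (μ : Measure ℝ) {f : ℝ → ℝ≥0∞} (hf : Measurable f)
    (c : ℝ≥0∞) : c * μ {x | c < intervalMax μ f x} ≤ 2 * ∫⁻ t, f t ∂μ := by
  set S : Set (ℚ × ℚ) :=
    {I | c * μ (Ioo (I.1 : ℝ) I.2) ≤ ∫⁻ t in Ioo (I.1 : ℝ) I.2, f t ∂μ} with hS
  have hsub : {x | c < intervalMax μ f x} ⊆
      ⋃ s : Finset S, ⋃ I ∈ s.map (Function.Embedding.subtype _), Ioo (I.1 : ℝ) I.2 := by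
    intro x hx
    obtain ⟨I, hI⟩ := lt_iSup_iff.1 (mem_ofPred.1 hx)
    by_cases hxI : x ∈ Ioo (I.1 : ℝ) I.2
    · rw [indicator_of_mem hxI] at hI
      have hIS : I ∈ S := by
        have h2 := mul_le_mul_left hI.le (μ (Ioo (I.1 : ℝ) I.2))
        refine h2.trans ?_
        rw [mul_comm, ← mul_assoc]
        exact mul_le_of_le_one_left' (ENNReal.mul_inv_le_one _)
      simp only [mem_iUnion]
      exact ⟨{⟨I, hIS⟩}, I, by simp, hxI⟩
    · simp [indicator_of_notMem hxI] at hI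
  have hdir : Directed (· ⊆ ·) fun s : Finset S =>
      ⋃ I ∈ s.map (Function.Embedding.subtype _), Ioo (I.1 : ℝ) I.2 := by
    refine Monotone.directed_le fun s t hst => ?_
    exact biUnion_subset_biUnion_left fun I hI => Finset.map_subset_map.2 hst hI
  refine (mul_le_mul_right (measure_mono hsub) c).trans ?_
  rw [hdir.measure_iUnion, ENNReal.mul_iSup]
  refine iSup_le fun s => mul_measure_biUnion_le μ hf _ fun I hI => ?_
  obtain ⟨J, -, rfl⟩ := Finset.mem_map.1 hI
  exact J.2

theorem intervalMax_le_add_const (μ : Measure ℝ) {f g : ℝ → ℝ≥0∞}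
    (c : ℝ≥0∞) (hfg : ∀ t, f t ≤ g t + c) (x : ℝ) :
    intervalMax μ f x ≤ intervalMax μ g x + c := by
  refine intervalMax_le fun I hI => ?_
  calc (μ (Ioo (I.1 : ℝ) I.2))⁻¹ * ∫⁻ t in Ioo (I.1 : ℝ) I.2, f t ∂μ
      ≤ (μ (Ioo (I.1 : ℝ) I.2))⁻¹ * ∫⁻ t in Ioo (I.1 : ℝ) I.2, (g t + c) ∂μ := by
        gcongr with t
        exact hfg t
    _ = (μ (Ioo (I.1 : ℝ) I.2))⁻¹ * (∫⁻ t in Ioo (I.1 : ℝ) I.2, g t ∂μ) +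
          c * ((μ (Ioo (I.1 : ℝ) I.2))⁻¹ * μ (Ioo (I.1 : ℝ) I.2)) := by
        rw [lintegral_add_right _ measurable_const, setLIntegral_const, mul_add]
        ring
    _ ≤ intervalMax μ g x + c := by
        gcongr
        · exact average_le_intervalMax μ g hI
        · exact mul_le_of_le_one_right' (ENNReal.inv_mul_le_one _)

theorem rpow_eq_lintegral {r : ℝ} (hr : 0 < r) (y : ℝ≥0∞) :
    y ^ r = ENNReal.ofReal r * ∫⁻ l in Ioi (0 : ℝ),
      {l : ℝ | ENNReal.ofReal l < y}.indicator (fun l => ENNReal.ofReal (l ^ (r - 1))) l := by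
  have hreal : ∀ z : ℝ≥0, (z : ℝ≥0∞) ^ r = ENNReal.ofReal r * ∫⁻ l in Ioi (0 : ℝ),
      {l : ℝ | ENNReal.ofReal l < z}.indicator (fun l => ENNReal.ofReal (l ^ (r - 1))) l := by
    intro z
    have := lintegral_rpow_eq_lintegral_meas_lt_mul (Measure.dirac ()) (f := fun _ => (z : ℝ))
      (Eventually.of_forall fun _ => z.coe_nonneg) measurable_const.aemeasurable hr
    rw [lintegral_dirac, ← ENNReal.ofReal_rpow_of_nonneg z.coe_nonneg hr.le,
      ENNReal.ofReal_coe_nnreal]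
      at this
    rw [this]
    congr 1
    refine setLIntegral_congr_fun measurableSet_Ioi fun l hl => ?_
    have hiff : ENNReal.ofReal l < z ↔ l < z := by
      rw [← ENNReal.ofReal_coe_nnreal, ENNReal.ofReal_lt_ofReal_iff_of_nonneg (le_of_lt hl)]
    by_cases h : l < z
    · simp [indicator, hiff, h]
    · simp [indicator, hiff, h]
  induction y with
  | coe z => exact hreal z
  | top =>
    rw [ENNReal.top_rpow_of_pos hr]
    refine (top_le_iff.1 ?_).symm
    have hlim : Tendsto (fun k : ℕ => (((k : ℝ≥0) : ℝ≥0∞)) ^ r) atTop (𝓝 ∞) := by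
      have := (ENNReal.continuous_rpow_const (y := r)).tendsto ∞
      rw [ENNReal.top_rpow_of_pos hr] at this
      exact this.comp (by simpa using ENNReal.tendsto_nat_nhds_top)
    refine le_of_tendsto hlim (Eventually.of_forall fun k => ?_)
    rw [hreal]
    gcongr
    exact le_top

theorem lintegral_intervalMax_rpow_le (μ : Measure ℝ) [SFinite μ] {t : ℝ} (ht : 1 < t)
    {f : ℝ → ℝ≥0∞} (hf : Measurable f) :
    ∫⁻ x, intervalMax μ f x ^ t ∂μ ≤
      ENNReal.ofReal t * (4 * ((ENNReal.ofReal (t - 1))⁻¹ * 2 ^ (t - 1))) * ∫⁻ x, f x ^ t ∂μ := by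
  have hM := measurable_intervalMax μ f
  have hset : MeasurableSet {z : ℝ × ℝ | ENNReal.ofReal z.2 < intervalMax μ f z.1} :=
    measurableSet_lt (by fun_prop) (by fun_prop)
  have hset' : MeasurableSet {z : ℝ × ℝ | ENNReal.ofReal z.2 < 2 * f z.1} :=
    measurableSet_lt (by fun_prop) (by fun_prop)
  have hweak : ∀ l ∈ Ioi (0 : ℝ), ENNReal.ofReal (l ^ (t - 1)) *
      μ {x | ENNReal.ofReal l < intervalMax μ f x} ≤
      4 * ∫⁻ x, f x * {x | ENNReal.ofReal l < 2 * f x}.indicator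
        (fun _ => ENNReal.ofReal (l ^ (t - 1 - 1))) x ∂μ := by
    intro l hl
    have hl0 : (0 : ℝ) < l := hl
    set c := ENNReal.ofReal (l / 2) with hc
    have hc2 : ENNReal.ofReal l = c + c := by
      rw [hc, ← ENNReal.ofReal_add (by positivity) (by positivity)]
      congr 1; ring
    set g : ℝ → ℝ≥0∞ := {x | ENNReal.ofReal l < 2 * f x}.indicator f with hg
    have hS : MeasurableSet {x | ENNReal.ofReal l < 2 * f x} :=
      measurableSet_lt measurable_const (hf.const_mul 2)
    have hgm : Measurable g := hf.indicator hS
    have hfg : ∀ x, f x ≤ g x + c := by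
      intro x
      by_cases hx : x ∈ {x | ENNReal.ofReal l < 2 * f x}
      · rw [hg, indicator_of_mem hx]; exact le_self_add
      · rw [hg, indicator_of_notMem hx, zero_add]
        simp only [mem_ofPred_eq, not_lt, hc2, ← two_mul] at hx
        exact (ENNReal.mul_le_mul_iff_right two_ne_zero ENNReal.ofNat_ne_top).1 hx
    have hsub : {x | ENNReal.ofReal l < intervalMax μ f x} ⊆ {x | c < intervalMax μ g x} := by
      intro x hx
      have h1 : c + c < intervalMax μ g x + c := by
        rw [← hc2]
        exact lt_of_lt_of_le hx (intervalMax_le_add_const μ c hfg x)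
      exact lt_of_add_lt_add_right h1
    have hpow : ENNReal.ofReal (l ^ (t - 1)) = ENNReal.ofReal (l ^ (t - 1 - 1)) * (2 * c) := by
      rw [two_mul, ← hc2, ← ENNReal.ofReal_mul (by positivity)]
      congr 1
      rw [← Real.rpow_add_one hl0.ne']
      congr 1; ring
    calc ENNReal.ofReal (l ^ (t - 1)) * μ {x | ENNReal.ofReal l < intervalMax μ f x}
        ≤ ENNReal.ofReal (l ^ (t - 1)) * μ {x | c < intervalMax μ g x} := by gcongr
      _ = ENNReal.ofReal (l ^ (t - 1 - 1)) * 2 * (c * μ {x | c < intervalMax μ g x}) := by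
          rw [hpow]; ring
      _ ≤ ENNReal.ofReal (l ^ (t - 1 - 1)) * 2 * (2 * ∫⁻ x, g x ∂μ) := by
          gcongr _ * ?_
          exact mul_measure_lt_intervalMax_le μ hgm c
      _ = 4 * ∫⁻ x, ENNReal.ofReal (l ^ (t - 1 - 1)) * g x ∂μ := by
          rw [lintegral_const_mul _ hgm]; ring
      _ = _ := by
          congr 2 with x
          by_cases hx : ENNReal.ofReal l < 2 * f x
          · simp [hg, indicator, mul_comm]
          · simp [hg, indicator, hx]
  have hpw : Measurable fun l : ℝ => ENNReal.ofReal (l ^ (t - 1)) := by fun_prop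
  have hpw' : Measurable fun l : ℝ => ENNReal.ofReal (l ^ (t - 1 - 1)) := by fun_prop
  calc ∫⁻ x, intervalMax μ f x ^ t ∂μ
      = ENNReal.ofReal t * ∫⁻ x, ∫⁻ l in Ioi (0 : ℝ),
          {l : ℝ | ENNReal.ofReal l < intervalMax μ f x}.indicator
            (fun l => ENNReal.ofReal (l ^ (t - 1))) l ∂volume ∂μ := by
        rw [← lintegral_const_mul']
        · exact lintegral_congr fun x => rpow_eq_lintegral (by linarith) _
        · exact ENNReal.ofReal_ne_top
    _ = ENNReal.ofReal t * ∫⁻ l in Ioi (0 : ℝ), ∫⁻ x,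
          {l : ℝ | ENNReal.ofReal l < intervalMax μ f x}.indicator
            (fun l => ENNReal.ofReal (l ^ (t - 1))) l ∂μ := by
        rw [lintegral_lintegral_swap]
        exact ((hpw.comp measurable_snd).indicator hset).aemeasurable
    _ = ENNReal.ofReal t * ∫⁻ l in Ioi (0 : ℝ), ENNReal.ofReal (l ^ (t - 1)) *
          μ {x | ENNReal.ofReal l < intervalMax μ f x} := by
        congr 2 with l
        rw [← lintegral_indicator_const (measurableSet_lt measurable_const hM)]
        rfl
    _ ≤ ENNReal.ofReal t * ∫⁻ l in Ioi (0 : ℝ), 4 * ∫⁻ x, f x *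
          {x | ENNReal.ofReal l < 2 * f x}.indicator
            (fun _ => ENNReal.ofReal (l ^ (t - 1 - 1))) x ∂μ := by
        gcongr ENNReal.ofReal t * ?_
        exact setLIntegral_mono' measurableSet_Ioi hweak
    _ = ENNReal.ofReal t * (4 * ∫⁻ x, f x * ∫⁻ l in Ioi (0 : ℝ),
          {l : ℝ | ENNReal.ofReal l < 2 * f x}.indicator
            (fun l => ENNReal.ofReal (l ^ (t - 1 - 1))) l ∂volume ∂μ) := by
        rw [lintegral_const_mul' _ _ ENNReal.ofNat_ne_top, lintegral_lintegral_swap]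
        · congr 3 with x
          rw [lintegral_const_mul]
          · rfl
          · exact hpw'.indicator (measurableSet_lt (by fun_prop) (by fun_prop))
        · have := (hf.comp measurable_snd).mul ((hpw'.comp measurable_fst).indicator
            (hset'.preimage measurable_swap))
          exact this.aemeasurable
    _ = ENNReal.ofReal t * (4 * ∫⁻ x, (ENNReal.ofReal (t - 1))⁻¹ * 2 ^ (t - 1) * f x ^ t ∂μ) := by
        congr 3 with x
        have h1 := rpow_eq_lintegral (r := t - 1) (by linarith) (2 * f x)
        have h0 : ENNReal.ofReal (t - 1) ≠ 0 := by simpa using ht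
        rw [ENNReal.mul_rpow_of_nonneg _ _ (by linarith)] at h1
        have h2 : f x ^ t = f x * f x ^ (t - 1) := by
          conv_lhs => rw [show t = 1 + (t - 1) by ring]
          rw [ENNReal.rpow_add_of_nonneg _ _ zero_le_one (by linarith), ENNReal.rpow_one]
        rw [h2, show (ENNReal.ofReal (t - 1))⁻¹ * 2 ^ (t - 1) * (f x * f x ^ (t - 1)) =
          f x * ((ENNReal.ofReal (t - 1))⁻¹ * (2 ^ (t - 1) * f x ^ (t - 1))) by ring, h1,
          ← mul_assoc (ENNReal.ofReal (t - 1))⁻¹, ENNReal.inv_mul_cancel h0 ENNReal.ofReal_ne_top,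
          one_mul]
    _ = _ := by
        rw [lintegral_const_mul _ (by fun_prop)]
        ring

section TwoWeights

variable {u v : ℝ → ℝ≥0∞} {Λ : ℝ≥0∞} {t : ℝ}

theorem ENNReal.rpow_le_rpow_of_exponent_nonpos {x y : ℝ≥0∞} {z : ℝ} (hz : z ≤ 0) (h : x ≤ y) :
    y ^ z ≤ x ^ z := by
  rw [← neg_neg z, ENNReal.rpow_neg y, ENNReal.rpow_neg x, ENNReal.inv_le_inv]
  exact ENNReal.rpow_le_rpow h (by linarith)

theorem setLIntegral_ne_zero_of_ae_pos {J : Set ℝ} (hJ0 : volume J ≠ 0)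
    {w : ℝ → ℝ≥0∞} (hw : Measurable w) (hw0 : ∀ᵐ y, w y ≠ 0) : ∫⁻ y in J, w y ≠ 0 := by
  intro h0
  have : (ae (volume.restrict J)).NeBot := by
    rw [ae_neBot, Ne, Measure.restrict_eq_zero]
    exact hJ0
  rw [lintegral_eq_zero_iff hw] at h0
  obtain ⟨y, h1, h2⟩ := (h0.and (ae_restrict_of_ae hw0)).exists
  exact h2 h1

/-- The average of an `A₁` weight over an interval is finite and positive, and bounded by the
values of the weight. -/
theorem average_weight (hu : Measurable u) (hu0 : ∀ x, 0 < u x) (hufin : ∀ᵐ x, u x < ∞)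
    (huA : ∀ x, intervalMax volume u x ≤ Λ * u x) (hΛ : Λ ≠ ∞) {I : ℚ × ℚ}
    (hJ0 : volume (Ioo (I.1 : ℝ) I.2) ≠ 0) (hJ : volume (Ioo (I.1 : ℝ) I.2) ≠ ∞) :
    ∃ U : ℝ≥0∞, U ≠ 0 ∧ U ≠ ∞ ∧ (∫⁻ y in Ioo (I.1 : ℝ) I.2, u y) =
      volume (Ioo (I.1 : ℝ) I.2) * U ∧ ∀ y ∈ Ioo (I.1 : ℝ) I.2, U ≤ Λ * u y := by
  refine ⟨(volume (Ioo (I.1 : ℝ) I.2))⁻¹ * ∫⁻ y in Ioo (I.1 : ℝ) I.2, u y, ?_, ?_, ?_, ?_⟩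
  · exact mul_ne_zero (ENNReal.inv_ne_zero.2 hJ) (setLIntegral_ne_zero_of_ae_pos
      hJ0 hu (Eventually.of_forall fun x => (hu0 x).ne'))
  · have : (ae (volume.restrict (Ioo (I.1 : ℝ) I.2))).NeBot := by
      rw [ae_neBot, Ne, Measure.restrict_eq_zero]
      exact hJ0
    obtain ⟨y, h1, h2⟩ :=
      ((ae_restrict_mem (μ := volume) (measurableSet_Ioo (a := (I.1 : ℝ)) (b := I.2))).and
        (ae_restrict_of_ae hufin)).exists
    exact ((average_le_intervalMax volume u h1).trans_lt
      ((huA y).trans_lt (ENNReal.mul_lt_top hΛ.lt_top h2))).ne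
  · rw [← mul_assoc, ENNReal.mul_inv_cancel hJ0 hJ, one_mul]
  · exact fun y hy => (average_le_intervalMax volume u hy).trans (huA y)

theorem average_rpow_le (ht : 1 < t) (hΛ0 : Λ ≠ 0) (hΛ : Λ ≠ ∞)
    (hu : Measurable u) (hu0 : ∀ x, 0 < u x) (hufin : ∀ᵐ x, u x < ∞)
    (huA : ∀ x, intervalMax volume u x ≤ Λ * u x)
    (hv : Measurable v) (hv0 : ∀ x, 0 < v x) (hvfin : ∀ᵐ x, v x < ∞)
    (hvA : ∀ x, intervalMax volume v x ≤ Λ * v x)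
    {σ W : ℝ → ℝ≥0∞} (hσ : σ = fun y => u y * v y ^ (-(1 / (t - 1))))
    (hW : W = fun y => u y ^ (1 - t) * v y)
    {f : ℝ → ℝ≥0∞} (hf : Measurable f) (x : ℝ) :
    intervalMax volume f x ^ (t - 1) ≤ Λ ^ (t - 1) * Λ *
      intervalMax (volume.withDensity W)
        (fun y => intervalMax (volume.withDensity σ) (fun z => f z * (σ z)⁻¹) y ^ (t - 1) *
          (W y)⁻¹) x := by
  have ht1 : 0 < t - 1 := by linarith
  have hσm : Measurable σ := by rw [hσ]; fun_prop
  have hWm : Measurable W := by rw [hW]; fun_prop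
  have hσ0 : ∀ᵐ y, σ y ≠ 0 ∧ σ y ≠ ∞ := by
    filter_upwards [hufin, hvfin] with y h1 h2
    rw [hσ]
    exact ⟨mul_ne_zero (hu0 y).ne' (ENNReal.rpow_pos (hv0 y) h2.ne).ne',
      ENNReal.mul_ne_top h1.ne (ENNReal.rpow_ne_top_of_ne_zero (hv0 y).ne' h2.ne)⟩
  have hW0 : ∀ᵐ y, W y ≠ 0 ∧ W y ≠ ∞ := by
    filter_upwards [hufin, hvfin] with y h1 h2
    rw [hW]
    exact ⟨mul_ne_zero (ENNReal.rpow_pos (hu0 y) h1.ne).ne' (hv0 y).ne',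
      ENNReal.mul_ne_top (ENNReal.rpow_ne_top_of_ne_zero (hu0 y).ne' h1.ne) h2.ne⟩
  set Mσ := intervalMax (volume.withDensity σ) (fun z => f z * (σ z)⁻¹) with hMσ
  set H : ℝ → ℝ≥0∞ := fun y => Mσ y ^ (t - 1) * (W y)⁻¹ with hH
  have hMσm : Measurable Mσ := measurable_intervalMax _ _
  have hHm : Measurable H := by rw [hH]; fun_prop
  have hroot : ∀ B : ℝ≥0∞, intervalMax volume f x ≤ B ^ (1 / (t - 1)) →
      intervalMax volume f x ^ (t - 1) ≤ B := by
    intro B hB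
    calc intervalMax volume f x ^ (t - 1) ≤ (B ^ (1 / (t - 1))) ^ (t - 1) := by gcongr
      _ = B := by rw [← ENNReal.rpow_mul, one_div_mul_cancel ht1.ne', ENNReal.rpow_one]
  refine hroot _ (intervalMax_le fun I hI => ?_)
  set J := Ioo (I.1 : ℝ) I.2 with hJdef
  have hJlt : (I.1 : ℝ) < I.2 := hI.1.trans hI.2
  have hJ0 : volume J ≠ 0 := by simpa [hJdef, Real.volume_Ioo] using hJlt
  have hJt : volume J ≠ ∞ := by simp [hJdef, Real.volume_Ioo]
  obtain ⟨U, hU0, hUt, hUJ, hUle⟩ := average_weight hu hu0 hufin huA hΛ hJ0 hJt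
  obtain ⟨V, hV0, hVt, hVJ, hVle⟩ := average_weight hv hv0 hvfin hvA hΛ hJ0 hJt
  set U' := Λ⁻¹ * U with hU'
  set V' := Λ⁻¹ * V with hV'
  have hUU : U = Λ * U' := by rw [hU', ← mul_assoc, ENNReal.mul_inv_cancel hΛ0 hΛ, one_mul]
  have hVV : V = Λ * V' := by rw [hV', ← mul_assoc, ENNReal.mul_inv_cancel hΛ0 hΛ, one_mul]
  have hU'0 : U' ≠ 0 := mul_ne_zero (ENNReal.inv_ne_zero.2 hΛ) hU0
  have hV'0 : V' ≠ 0 := mul_ne_zero (ENNReal.inv_ne_zero.2 hΛ) hV0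
  have hU't : U' ≠ ∞ := ENNReal.mul_ne_top (ENNReal.inv_ne_top.2 hΛ0) hUt
  have hV't : V' ≠ ∞ := ENNReal.mul_ne_top (ENNReal.inv_ne_top.2 hΛ0) hVt
  have hU'le : ∀ y ∈ J, U' ≤ u y := fun y hy => by
    have := hUle y hy
    rw [hUU] at this
    exact (ENNReal.mul_le_mul_iff_right hΛ0 hΛ).1 this
  have hV'le : ∀ y ∈ J, V' ≤ v y := fun y hy => by
    have := hVle y hy
    rw [hVV] at this
    exact (ENNReal.mul_le_mul_iff_right hΛ0 hΛ).1 this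
  have hneg : -(1 / (t - 1)) ≤ 0 := neg_nonpos.2 (by positivity)
  have hneg' : 1 - t ≤ 0 := by linarith
  set S := ∫⁻ y in J, σ y with hS
  set Q := ∫⁻ y in J, W y with hQ
  have hSle : S ≤ V' ^ (-(1 / (t - 1))) * (volume J * U) := by
    rw [← hUJ, ← lintegral_const_mul _ hu]
    refine setLIntegral_mono' measurableSet_Ioo fun y hy => ?_
    rw [hσ, mul_comm (_ ^ _)]
    exact mul_le_mul_right (ENNReal.rpow_le_rpow_of_exponent_nonpos hneg (hV'le y hy)) _
  have hQle : Q ≤ U' ^ (1 - t) * (volume J * V) := by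
    rw [← hVJ, ← lintegral_const_mul _ hv]
    refine setLIntegral_mono' measurableSet_Ioo fun y hy => ?_
    rw [hW]
    exact mul_le_mul_left (ENNReal.rpow_le_rpow_of_exponent_nonpos hneg' (hU'le y hy)) _
  have hS0 : S ≠ 0 := setLIntegral_ne_zero_of_ae_pos hJ0 hσm
    (hσ0.mono fun y h => h.1)
  have hSt : S ≠ ∞ := ne_top_of_le_ne_top (ENNReal.mul_ne_top
    (ENNReal.rpow_ne_top_of_ne_zero hV'0 hV't) (ENNReal.mul_ne_top hJt hUt)) hSle
  have hS' : (volume.withDensity σ) J = S := withDensity_apply _ measurableSet_Ioo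
  have hQ' : (volume.withDensity W) J = Q := withDensity_apply _ measurableSet_Ioo
  set A := S⁻¹ * ∫⁻ y in J, f y with hA
  have hAle : ∀ y ∈ J, A ≤ Mσ y := by
    intro y hy
    have h1 := average_le_intervalMax (volume.withDensity σ) (fun z => f z * (σ z)⁻¹) hy
    have h2 : ∫⁻ z in J, f z * (σ z)⁻¹ ∂(volume.withDensity σ) = ∫⁻ z in J, f z := by
      rw [setLIntegral_withDensity_eq_setLIntegral_mul _ hσm (hf.fun_mul hσm.fun_inv)
        measurableSet_Ioo]
      refine lintegral_congr_ae (ae_restrict_of_ae ?_)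
      filter_upwards [hσ0] with z hz
      rw [Pi.mul_apply, mul_left_comm, ENNReal.mul_inv_cancel hz.1 hz.2, mul_one]
    rw [← hJdef, h2, hS'] at h1
    exact h1
  have hfA : ∫⁻ y in J, f y = S * A := by
    rw [hA, ← mul_assoc, ENNReal.mul_inv_cancel hS0 hSt, one_mul]
  have hlow : volume J * A ^ (t - 1) ≤ ∫⁻ y in J, H y ∂(volume.withDensity W) := by
    rw [setLIntegral_withDensity_eq_setLIntegral_mul _ hWm hHm measurableSet_Ioo]
    calc volume J * A ^ (t - 1) = ∫⁻ _ in J, A ^ (t - 1) := by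
          rw [setLIntegral_const, mul_comm]
      _ ≤ ∫⁻ y in J, Mσ y ^ (t - 1) := by
          refine setLIntegral_mono' measurableSet_Ioo fun y hy => ?_
          gcongr
          exact hAle y hy
      _ = _ := by
          refine lintegral_congr_ae (ae_restrict_of_ae ?_)
          filter_upwards [hW0] with z hz
          rw [Pi.mul_apply, hH]
          simp only
          rw [mul_left_comm, ENNReal.mul_inv_cancel hz.1 hz.2, mul_one]
  have hmax : Q⁻¹ * (volume J * A ^ (t - 1)) ≤ intervalMax (volume.withDensity W) H x := by
    refine le_trans ?_ (average_le_intervalMax (volume.withDensity W) H hI)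
    rw [← hJdef, hQ']
    gcongr
  have hQinv : U' ^ (t - 1) * ((volume J)⁻¹ * V⁻¹) ≤ Q⁻¹ := by
    refine le_trans (le_of_eq ?_) (ENNReal.inv_le_inv.2 hQle)
    rw [ENNReal.mul_inv (Or.inr (ENNReal.mul_ne_top hJt hVt)) (Or.inr (mul_ne_zero hJ0 hV0)),
      ENNReal.mul_inv (Or.inl hJ0) (Or.inl hJt), ← ENNReal.rpow_neg, neg_sub]
  have hmain : ((volume J)⁻¹ * ∫⁻ y in J, f y) ^ (t - 1) ≤
      Λ ^ (t - 1) * Λ * intervalMax (volume.withDensity W) H x := by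
    calc ((volume J)⁻¹ * ∫⁻ y in J, f y) ^ (t - 1)
        ≤ ((volume J)⁻¹ * ((V' ^ (-(1 / (t - 1))) * (volume J * U)) * A)) ^ (t - 1) := by
          rw [hfA]; gcongr
      _ = (V' ^ (-(1 / (t - 1))) * U * A) ^ (t - 1) := by
          congr 1
          rw [show (volume J)⁻¹ * ((V' ^ (-(1 / (t - 1))) * (volume J * U)) * A) =
            ((volume J)⁻¹ * volume J) * (V' ^ (-(1 / (t - 1))) * U * A) by ring,
            ENNReal.inv_mul_cancel hJ0 hJt, one_mul]
      _ = V'⁻¹ * U ^ (t - 1) * A ^ (t - 1) := by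
          rw [ENNReal.mul_rpow_of_nonneg _ _ ht1.le, ENNReal.mul_rpow_of_nonneg _ _ ht1.le,
            ← ENNReal.rpow_mul, neg_mul, one_div_mul_cancel ht1.ne', ENNReal.rpow_neg_one]
      _ = Λ ^ (t - 1) * Λ * ((U' ^ (t - 1) * ((volume J)⁻¹ * V⁻¹)) *
            (volume J * A ^ (t - 1))) := by
          have e1 : V'⁻¹ = Λ * V⁻¹ := by
            rw [hV', ENNReal.mul_inv (Or.inr hVt) (Or.inr hV0), inv_inv]
          have e2 : U ^ (t - 1) = Λ ^ (t - 1) * U' ^ (t - 1) := by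
            rw [← ENNReal.mul_rpow_of_nonneg _ _ ht1.le, ← hUU]
          rw [e1, e2]
          rw [show Λ ^ (t - 1) * Λ * ((U' ^ (t - 1) * ((volume J)⁻¹ * V⁻¹)) *
            (volume J * A ^ (t - 1))) = ((volume J)⁻¹ * volume J) *
            (Λ * V⁻¹ * (Λ ^ (t - 1) * U' ^ (t - 1)) * A ^ (t - 1)) by ring,
            ENNReal.inv_mul_cancel hJ0 hJt, one_mul]
      _ ≤ Λ ^ (t - 1) * Λ * (Q⁻¹ * (volume J * A ^ (t - 1))) := by gcongr
      _ ≤ Λ ^ (t - 1) * Λ * intervalMax (volume.withDensity W) H x := by gcongr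
  calc (volume J)⁻¹ * ∫⁻ y in J, f y
      = (((volume J)⁻¹ * ∫⁻ y in J, f y) ^ (t - 1)) ^ (1 / (t - 1)) := by
        rw [← ENNReal.rpow_mul, mul_one_div_cancel ht1.ne', ENNReal.rpow_one]
    _ ≤ _ := by gcongr

/-- Muckenhoupt's theorem for weights of the factored form `u ^ (1 - t) * v`. -/
theorem exists_lintegral_intervalMax_rpow_mul_weight_le (ht : 1 < t) (hΛ0 : Λ ≠ 0) (hΛ : Λ ≠ ∞) :
    ∃ C : ℝ≥0∞, C ≠ ∞ ∧ ∀ u v : ℝ → ℝ≥0∞, Measurable u → (∀ x, 0 < u x) → (∀ᵐ x, u x < ∞) →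
      (∀ x, intervalMax volume u x ≤ Λ * u x) → Measurable v → (∀ x, 0 < v x) →
      (∀ᵐ x, v x < ∞) → (∀ x, intervalMax volume v x ≤ Λ * v x) →
      ∀ f : ℝ → ℝ≥0∞, Measurable f →
        ∫⁻ x, intervalMax volume f x ^ t * (u x ^ (1 - t) * v x) ≤
          C * ∫⁻ x, f x ^ t * (u x ^ (1 - t) * v x) := by
  have ht1 : 0 < t - 1 := by linarith
  set t' := t / (t - 1) with ht'
  have ht'1 : 1 < t' := by rw [ht', one_lt_div ht1]; linarith
  set D : ℝ → ℝ≥0∞ := fun r =>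
    ENNReal.ofReal r * (4 * ((ENNReal.ofReal (r - 1))⁻¹ * 2 ^ (r - 1))) with hD
  have hDt : ∀ r : ℝ, 1 < r → D r ≠ ∞ := by
    intro r hr
    refine ENNReal.mul_ne_top ENNReal.ofReal_ne_top (ENNReal.mul_ne_top ENNReal.ofNat_ne_top
      (ENNReal.mul_ne_top (ENNReal.inv_ne_top.2 (by simpa using hr))
        (ENNReal.rpow_ne_top_of_nonneg (by linarith) ENNReal.ofNat_ne_top)))
  refine ⟨(Λ ^ (t - 1) * Λ) ^ t' * (D t' * D t), ?_, ?_⟩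
  · exact ENNReal.mul_ne_top (ENNReal.rpow_ne_top_of_nonneg (by positivity) (ENNReal.mul_ne_top
      (ENNReal.rpow_ne_top_of_nonneg ht1.le hΛ) hΛ)) (ENNReal.mul_ne_top (hDt _ ht'1) (hDt _ ht))
  intro u v hu hu0 hufin huA hv hv0 hvfin hvA f hf
  set σ : ℝ → ℝ≥0∞ := fun y => u y * v y ^ (-(1 / (t - 1))) with hσ
  set W : ℝ → ℝ≥0∞ := fun y => u y ^ (1 - t) * v y with hW
  have hσm : Measurable σ := by rw [hσ]; fun_prop
  have hWm : Measurable W := by rw [hW]; fun_prop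
  set Mσ := intervalMax (volume.withDensity σ) (fun z => f z * (σ z)⁻¹) with hMσ
  have hMσm : Measurable Mσ := measurable_intervalMax _ _
  set H : ℝ → ℝ≥0∞ := fun y => Mσ y ^ (t - 1) * (W y)⁻¹ with hH
  have hHm : Measurable H := by rw [hH]; fun_prop
  have hMfm : Measurable (intervalMax volume f) := measurable_intervalMax _ _
  have hMWm : Measurable (intervalMax (volume.withDensity W) H) := measurable_intervalMax _ _
  have hpt : ∀ x, intervalMax volume f x ^ t ≤
      (Λ ^ (t - 1) * Λ) ^ t' * intervalMax (volume.withDensity W) H x ^ t' := by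
    intro x
    have h := average_rpow_le ht hΛ0 hΛ hu hu0 hufin huA hv hv0 hvfin hvA hσ hW hf x
    calc intervalMax volume f x ^ t = (intervalMax volume f x ^ (t - 1)) ^ t' := by
          rw [← ENNReal.rpow_mul, ht', mul_div_cancel₀ _ ht1.ne']
      _ ≤ (Λ ^ (t - 1) * Λ * intervalMax (volume.withDensity W) H x) ^ t' := by gcongr
      _ = _ := ENNReal.mul_rpow_of_nonneg _ _ (by positivity)
  have hHW : ∀ᵐ y, W y * H y ^ t' = σ y * Mσ y ^ t := by
    filter_upwards [hufin, hvfin] with y h1 h2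
    have hWy : W y ≠ 0 ∧ W y ≠ ∞ :=
      ⟨mul_ne_zero (ENNReal.rpow_pos (hu0 y) h1.ne).ne' (hv0 y).ne',
        ENNReal.mul_ne_top (ENNReal.rpow_ne_top_of_ne_zero (hu0 y).ne' h1.ne) h2.ne⟩
    have e1 : W y * (W y)⁻¹ ^ t' = σ y := by
      have : W y * (W y)⁻¹ ^ t' = W y ^ (-(1 / (t - 1))) := by
        rw [ENNReal.inv_rpow, ← ENNReal.rpow_neg]
        conv_lhs => rw [← ENNReal.rpow_one (W y), ← ENNReal.rpow_mul, one_mul]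
        rw [← ENNReal.rpow_add _ _ hWy.1 hWy.2, ht']
        congr 1; field_simp; ring
      rw [this]
      simp only [hW, hσ]
      rw [ENNReal.mul_rpow_of_ne_top (ENNReal.rpow_ne_top_of_ne_zero (hu0 y).ne' h1.ne) h2.ne,
        ← ENNReal.rpow_mul]
      congr 1
      rw [show (1 - t) * -(1 / (t - 1)) = 1 by field_simp; ring, ENNReal.rpow_one]
    simp only [hH]
    rw [ENNReal.mul_rpow_of_nonneg _ _ (by positivity), ← ENNReal.rpow_mul, ht',
      mul_div_cancel₀ _ ht1.ne', ← ht', mul_left_comm, e1, mul_comm]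
  have hσW : ∀ᵐ y, σ y * (f y * (σ y)⁻¹) ^ t = f y ^ t * W y := by
    filter_upwards [hufin, hvfin] with y h1 h2
    have hσy : σ y ≠ 0 ∧ σ y ≠ ∞ :=
      ⟨mul_ne_zero (hu0 y).ne' (ENNReal.rpow_pos (hv0 y) h2.ne).ne',
        ENNReal.mul_ne_top h1.ne (ENNReal.rpow_ne_top_of_ne_zero (hv0 y).ne' h2.ne)⟩
    have e1 : σ y * (σ y)⁻¹ ^ t = W y := by
      have : σ y * (σ y)⁻¹ ^ t = σ y ^ (1 - t) := by
        rw [ENNReal.inv_rpow, ← ENNReal.rpow_neg]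
        conv_lhs => rw [← ENNReal.rpow_one (σ y), ← ENNReal.rpow_mul, one_mul]
        rw [← ENNReal.rpow_add _ _ hσy.1 hσy.2, sub_eq_add_neg]
      rw [this]
      simp only [hW, hσ]
      rw [ENNReal.mul_rpow_of_ne_top h1.ne (ENNReal.rpow_ne_top_of_ne_zero (hv0 y).ne' h2.ne),
        ← ENNReal.rpow_mul]
      congr 1
      rw [show -(1 / (t - 1)) * (1 - t) = 1 by field_simp; ring, ENNReal.rpow_one]
    rw [ENNReal.mul_rpow_of_nonneg _ _ (by linarith), mul_left_comm, e1]
  calc ∫⁻ x, intervalMax volume f x ^ t * (u x ^ (1 - t) * v x)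
      ≤ ∫⁻ x, (Λ ^ (t - 1) * Λ) ^ t' *
          (W x * intervalMax (volume.withDensity W) H x ^ t') := by
        refine lintegral_mono fun x => ?_
        refine (mul_le_mul_left (hpt x) _).trans (le_of_eq ?_)
        rw [mul_assoc, mul_comm (W x)]
    _ = (Λ ^ (t - 1) * Λ) ^ t' *
          ∫⁻ x, intervalMax (volume.withDensity W) H x ^ t' ∂(volume.withDensity W) := by
        rw [lintegral_const_mul _ (by fun_prop),
          lintegral_withDensity_eq_lintegral_mul _ hWm (by fun_prop)]
        rfl
    _ ≤ (Λ ^ (t - 1) * Λ) ^ t' * (D t' * ∫⁻ x, H x ^ t' ∂(volume.withDensity W)) := by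
        gcongr
        exact lintegral_intervalMax_rpow_le _ ht'1 hHm
    _ = (Λ ^ (t - 1) * Λ) ^ t' * (D t' * ∫⁻ x, Mσ x ^ t ∂(volume.withDensity σ)) := by
        rw [lintegral_withDensity_eq_lintegral_mul _ hWm (by fun_prop),
          lintegral_withDensity_eq_lintegral_mul _ hσm (by fun_prop)]
        congr 2
        exact lintegral_congr_ae hHW
    _ ≤ (Λ ^ (t - 1) * Λ) ^ t' * (D t' *
          (D t * ∫⁻ x, (f x * (σ x)⁻¹) ^ t ∂(volume.withDensity σ))) := by
        gcongr
        exact lintegral_intervalMax_rpow_le _ ht (hf.fun_mul hσm.fun_inv)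
    _ = (Λ ^ (t - 1) * Λ) ^ t' * (D t' * (D t * ∫⁻ x, f x ^ t * W x)) := by
        rw [lintegral_withDensity_eq_lintegral_mul _ hσm ((hf.fun_mul hσm.fun_inv).pow_const t)]
        congr 3
        exact lintegral_congr_ae hσW
    _ = _ := by ring

end TwoWeights

theorem exists_Lp_norming {Ω : Type*} [MeasurableSpace Ω] {μ : Measure Ω} {q q' : ℝ}
    (hq : q.HolderConjugate q') {F : Ω → ℝ≥0∞} (hF : Measurable F) {G : ℝ≥0∞}
    (hG : G = (∫⁻ x, F x ^ q ∂μ) ^ (1 / q)) (hGt : G ≠ ∞) :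
    ∫⁻ x, F x * (F x ^ (q - 1) * (G ^ (q - 1))⁻¹) ∂μ = G ∧
      ∫⁻ x, (F x ^ (q - 1) * (G ^ (q - 1))⁻¹) ^ q' ∂μ ≤ 1 := by
  have hq0 : 0 < q := hq.pos
  have hq1 : 0 < q - 1 := sub_pos.2 hq.lt
  have hI : ∫⁻ x, F x ^ q ∂μ = G ^ q := by
    rw [hG, ← ENNReal.rpow_mul, one_div_mul_cancel hq0.ne', ENNReal.rpow_one]
  constructor
  · have h1 : ∀ x, F x * (F x ^ (q - 1) * (G ^ (q - 1))⁻¹) = F x ^ q * (G ^ (q - 1))⁻¹ := by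
      intro x
      rw [← mul_assoc]
      congr 1
      conv_lhs => rw [← ENNReal.rpow_one (F x), ← ENNReal.rpow_mul, one_mul]
      rw [← ENNReal.rpow_add_of_nonneg _ _ zero_le_one hq1.le, add_sub_cancel]
    simp_rw [h1]
    rw [lintegral_mul_const _ (by fun_prop), hI]
    rcases eq_or_ne G 0 with h0 | h0
    · simp [h0, hq0]
    · rw [← ENNReal.rpow_neg, ← ENNReal.rpow_add _ _ h0 hGt]
      simp
  · have h1 : ∀ x, (F x ^ (q - 1) * (G ^ (q - 1))⁻¹) ^ q' = F x ^ q * (G ^ q)⁻¹ := by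
      intro x
      rw [ENNReal.mul_rpow_of_nonneg _ _ hq.symm.nonneg, ENNReal.inv_rpow, ← ENNReal.rpow_mul,
        ← ENNReal.rpow_mul, hq.sub_one_mul_conj]
    simp_rw [h1]
    rw [lintegral_mul_const _ (by fun_prop), hI]
    exact ENNReal.mul_inv_le_one _

section MixedNorm

variable {m : ℕ}

theorem measurable_insertNth (j : Fin (m + 1)) :
    Measurable fun p : ℝ × (Fin m → ℝ) => (j.insertNth p.1 p.2 : Fin (m + 1) → ℝ) :=
  (MeasurableEquiv.piFinSuccAbove (fun _ => ℝ) j).symm.measurable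

theorem measurable_cons :
    Measurable fun p : ℝ × (Fin m → ℝ) => (Fin.cons p.1 p.2 : Fin (m + 1) → ℝ) := by
  simpa using measurable_insertNth (m := m) 0

theorem lintegral_insertNth (j : Fin (m + 1)) {f : (Fin (m + 1) → ℝ) → ℝ≥0∞}
    (hf : Measurable f) :
    ∫⁻ y, f y = ∫⁻ x : Fin m → ℝ, ∫⁻ t : ℝ, f (j.insertNth t x) := by
  have h := (volume_preserving_piFinSuccAbove (fun _ : Fin (m + 1) => ℝ) j).symm
  rw [← h.lintegral_comp hf, Measure.volume_eq_prod]
  exact lintegral_prod_symm' _ (hf.comp (measurable_insertNth j))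

theorem lintegral_cons {f : (Fin (m + 1) → ℝ) → ℝ≥0∞} (hf : Measurable f) :
    ∫⁻ y, f y = ∫⁻ x : Fin m → ℝ, ∫⁻ t : ℝ, f (Fin.cons t x) := by
  simpa using lintegral_insertNth 0 hf

theorem lintegral_fin_zero (f : (Fin 0 → ℝ) → ℝ≥0∞) : ∫⁻ y, f y = f ![] := by
  rw [volume_pi, Measure.pi_of_empty (fun _ => volume) ![], lintegral_dirac]

/-- The `L^q` norm in the first variable. -/
def innerNorm (q : ℝ) (f : (Fin (m + 1) → ℝ) → ℝ≥0∞) (x : Fin m → ℝ) : ℝ≥0∞ :=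
  (∫⁻ t : ℝ, f (Fin.cons t x) ^ q) ^ (1 / q)

theorem mixedNormAux_succ (q : Fin (m + 1) → ℝ) (f : (Fin (m + 1) → ℝ) → ℝ≥0∞) :
    mixedNormAux (m + 1) q f = mixedNormAux m (fun i => q i.succ) (innerNorm (q 0) f) := rfl

theorem measurable_innerNorm (q : ℝ) {f : (Fin (m + 1) → ℝ) → ℝ≥0∞} (hf : Measurable f) :
    Measurable (innerNorm q f) :=
  ((hf.comp measurable_cons).pow_const q).lintegral_prod_left'.pow_const _

theorem innerNorm_mono {q : ℝ} (hq : 0 ≤ q) {f g : (Fin (m + 1) → ℝ) → ℝ≥0∞}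
    (h : ∀ x, f x ≤ g x) (x : Fin m → ℝ) : innerNorm q f x ≤ innerNorm q g x := by
  unfold innerNorm
  gcongr
  exact h _

theorem mixedNormAux_mono (q : Fin m → ℝ) (hq : ∀ i, 0 ≤ q i) {f g : (Fin m → ℝ) → ℝ≥0∞}
    (h : ∀ x, f x ≤ g x) : mixedNormAux m q f ≤ mixedNormAux m q g := by
  induction m with
  | zero => exact h _
  | succ m ih => exact ih _ (fun i => hq i.succ) fun x => innerNorm_mono (hq 0) h x

theorem mixedNormAux_rpow {s : ℝ} (hs : 0 < s) (q : Fin m → ℝ) (f : (Fin m → ℝ) → ℝ≥0∞) :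
    mixedNormAux m (fun i => q i / s) (fun x => f x ^ s) = mixedNormAux m q f ^ s := by
  induction m with
  | zero => rfl
  | succ m ih =>
    rw [mixedNormAux_succ, mixedNormAux_succ, ← ih]
    congr 1
    funext x
    simp only [innerNorm]
    rw [← ENNReal.rpow_mul]
    simp_rw [← ENNReal.rpow_mul, mul_div_cancel₀ (q 0) hs.ne']
    rw [one_div_div, div_mul_eq_mul_div, one_mul]

theorem mixedNormAux_box {q : Fin m → ℝ} (hq : ∀ i, 0 < q i) (R : ℝ) (c : ℝ≥0∞) :
    mixedNormAux m q ({x | ∀ i, x i ∈ Ioo (-R) R}.indicator fun _ => c) =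
      c * ENNReal.ofReal (2 * R) ^ (∑ i, 1 / q i) := by
  induction m generalizing c with
  | zero => simp [mixedNormAux]
  | succ m ih =>
    rw [mixedNormAux_succ, Fin.sum_univ_succ, ENNReal.rpow_add_of_nonneg _ _
      (one_div_nonneg.2 (hq 0).le) (Finset.sum_nonneg fun i _ => one_div_nonneg.2 (hq _).le),
      ← mul_assoc, ← ih (fun i => hq i.succ)]
    congr 1
    funext x
    by_cases hx : ∀ i, x i ∈ Ioo (-R) R
    · rw [indicator_of_mem (show x ∈ {x | ∀ i, x i ∈ Ioo (-R) R} from hx)]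
      have h1 : ∀ t : ℝ, ({x | ∀ i, x i ∈ Ioo (-R) R}.indicator (fun _ => c)
          (Fin.cons t x : Fin (m + 1) → ℝ)) ^ q 0 =
            (Ioo (-R) R).indicator (fun _ => c ^ q 0) t := by
        intro t
        by_cases ht : t ∈ Ioo (-R) R
        · rw [indicator_of_mem ht, indicator_of_mem]
          exact Fin.forall_fin_succ.2 ⟨ht, hx⟩
        · rw [indicator_of_notMem ht, indicator_of_notMem, ENNReal.zero_rpow_of_pos (hq 0)]
          exact fun h => ht (h 0)
      simp only [innerNorm, h1]
      rw [lintegral_indicator measurableSet_Ioo, setLIntegral_const, Real.volume_Ioo,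
        ENNReal.mul_rpow_of_nonneg _ _ (one_div_nonneg.2 (hq 0).le), ← ENNReal.rpow_mul,
        mul_one_div_cancel (hq 0).ne', ENNReal.rpow_one, sub_neg_eq_add, ← two_mul]
    · rw [indicator_of_notMem (show x ∉ {x | ∀ i, x i ∈ Ioo (-R) R} from hx)]
      have h1 : ∀ t : ℝ, ({x | ∀ i, x i ∈ Ioo (-R) R}.indicator (fun _ => c)
          (Fin.cons t x : Fin (m + 1) → ℝ)) ^ q 0 = 0 := by
        intro t
        rw [indicator_of_notMem, ENNReal.zero_rpow_of_pos (hq 0)]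
        exact fun h => hx fun i => h i.succ
      simp only [innerNorm, h1]
      simp [hq 0]

theorem isKotheDual_mixedNormAux {q q' : Fin m → ℝ} (hq : ∀ i, (q i).HolderConjugate (q' i)) :
    IsKotheDual volume (mixedNormAux m q) (mixedNormAux m q') := by
  induction m with
  | zero =>
    refine ⟨fun f g _ _ => (lintegral_fin_zero _).le, fun f _ c hc =>
      ⟨1, measurable_one, le_rfl, ?_⟩⟩
    rw [lintegral_fin_zero]
    simpa [mixedNormAux] using hc
  | succ m ih =>
    have ih := ih fun i => hq i.succ
    refine ⟨fun f g hf hg => ?_, fun f hf c hc => ?_⟩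
    · rw [lintegral_cons (hf.fun_mul hg)]
      refine le_trans (lintegral_mono fun x => ?_) (ih.holder _ _ (measurable_innerNorm (q 0) hf)
        (measurable_innerNorm (q' 0) hg))
      exact ENNReal.lintegral_mul_le_Lp_mul_Lq _ (hq 0)
        ((hf.comp measurable_cons).comp measurable_prodMk_right).aemeasurable
        ((hg.comp measurable_cons).comp measurable_prodMk_right).aemeasurable
    · obtain ⟨h, hh, hh1, hch⟩ := ih.norming _ (measurable_innerNorm (q 0) hf) c hc
      set F : ℕ → (Fin (m + 1) → ℝ) → ℝ≥0∞ := fun k y =>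
        (Icc (-(k : ℝ)) k).indicator (fun _ => min (f y) k) (y 0) with hFdef
      have hF : ∀ k, Measurable (F k) := fun k => by
        have : F k = {y : Fin (m + 1) → ℝ | y 0 ∈ Icc (-(k : ℝ)) k}.indicator
          fun y => min (f y) k := by
          funext y; simp [hFdef, indicator_apply]
        rw [this]
        exact (hf.min measurable_const).indicator (measurable_pi_apply 0 measurableSet_Icc)
      have hFf : ∀ k y, F k y ≤ f y := fun k y =>
        (indicator_le_self' (fun _ _ => zero_le) _).trans (min_le_left _ _)
      have hFmono : ∀ y, Monotone fun k => F k y := by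
        intro y k l hkl
        have hkl' : (k : ℝ) ≤ l := by exact_mod_cast hkl
        refine (indicator_le_indicator_of_subset (Icc_subset_Icc (neg_le_neg hkl') hkl')
          (fun _ => zero_le) _).trans (indicator_le_indicator ?_)
        gcongr
      have hFsup : ∀ y, ⨆ k, F k y = f y := by
        intro y
        refine le_antisymm (iSup_le fun k => hFf k y) (le_of_forall_lt fun b hb => ?_)
        obtain ⟨k₁, hk₁⟩ := exists_nat_ge |y 0|
        obtain ⟨k₂, hk₂⟩ := ENNReal.exists_nat_gt (hb.trans_le le_top).ne
        refine lt_of_lt_of_le ?_ (le_iSup (fun k => F k y) (max k₁ k₂))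
        have h1 : |y 0| ≤ ((max k₁ k₂ : ℕ) : ℝ) := hk₁.trans (by exact_mod_cast le_max_left _ _)
        have h2 : (k₂ : ℝ≥0∞) ≤ ((max k₁ k₂ : ℕ) : ℝ≥0∞) := by exact_mod_cast le_max_right _ _
        simp only [hFdef]
        rw [indicator_of_mem (mem_Icc.2 (abs_le.1 h1))]
        exact lt_min hb (hk₂.trans_le h2)
      have hq0 : 0 < q 0 := (hq 0).pos
      set G : ℕ → (Fin m → ℝ) → ℝ≥0∞ := fun k => innerNorm (q 0) (F k) with hG
      have hGm : ∀ k, Measurable (G k) := fun k => measurable_innerNorm _ (hF k)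
      have hGt : ∀ k x, G k x ≠ ∞ := by
        intro k x
        refine ENNReal.rpow_ne_top_of_nonneg (one_div_nonneg.2 hq0.le) (ne_top_of_le_ne_top ?_
          (lintegral_mono (g := (Icc (-(k : ℝ)) k).indicator fun _ => (k : ℝ≥0∞) ^ q 0)
            fun t => ?_))
        · rw [lintegral_indicator measurableSet_Icc, setLIntegral_const, Real.volume_Icc]
          exact ENNReal.mul_ne_top (ENNReal.rpow_ne_top_of_nonneg hq0.le (natCast_ne_top _))
            ENNReal.ofReal_ne_top
        · by_cases ht : t ∈ Icc (-(k : ℝ)) k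
          · simp only [hFdef, Fin.cons_zero, indicator_of_mem ht]
            gcongr
            exact min_le_right _ _
          · simp [hFdef, indicator_of_notMem ht, hq0]
      have hGsup : ∀ x, innerNorm (q 0) f x = ⨆ k, G k x := by
        intro x
        have hmeas : ∀ k, Measurable fun t : ℝ => F k (Fin.cons t x) := fun k =>
          ((hF k).comp measurable_cons).comp measurable_prodMk_right
        have h1 : ∫⁻ t : ℝ, f (Fin.cons t x) ^ q 0 =
            ⨆ k, ∫⁻ t : ℝ, F k (Fin.cons t x) ^ q 0 := by
          rw [← lintegral_iSup (fun k => (hmeas k).pow_const _)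
            fun k l hkl t => ENNReal.rpow_le_rpow (hFmono _ hkl) hq0.le]
          refine lintegral_congr fun t => ?_
          rw [← hFsup]
          exact (ENNReal.orderIsoRpow (q 0) hq0).map_iSup _
        simp only [innerNorm, hG]
        rw [h1]
        exact (ENNReal.orderIsoRpow (1 / q 0) (one_div_pos.2 hq0)).map_iSup _
      have hGmono : ∀ x, Monotone fun k => G k x := fun x k l hkl =>
        innerNorm_mono hq0.le (fun y => hFmono y hkl) x
      obtain ⟨k, hk⟩ : ∃ k, c < ∫⁻ x, G k x * h x := by
        have h1 : ∫⁻ x, innerNorm (q 0) f x * h x = ⨆ k, ∫⁻ x, G k x * h x := by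
          rw [← lintegral_iSup (fun k => (hGm k).fun_mul hh)
            fun k l hkl x => mul_le_mul_left (hGmono x hkl) _]
          simp_rw [hGsup, ENNReal.iSup_mul]
        rw [h1] at hch
        exact lt_iSup_iff.1 hch
      have htail : Measurable (Fin.tail : (Fin (m + 1) → ℝ) → Fin m → ℝ) :=
        measurable_pi_iff.2 fun i => measurable_pi_apply _
      have hGk := hGm k
      have hFk := hF k
      have hgm : Measurable fun y : Fin (m + 1) → ℝ =>
          F k y ^ (q 0 - 1) * (G k (Fin.tail y) ^ (q 0 - 1))⁻¹ * h (Fin.tail y) := by fun_prop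
      refine ⟨_, hgm, ?_, hk.trans_le ?_⟩
      · refine (mixedNormAux_mono _ (fun i => (hq i.succ).symm.nonneg) fun x => ?_).trans hh1
        have hFx : Measurable fun t : ℝ => F k (Fin.cons t x) :=
          (hFk.comp measurable_cons).comp measurable_prodMk_right
        have h1 := (exists_Lp_norming (G := G k x) (hq 0) hFx rfl (hGt k x)).2
        simp only [Fin.tail_cons, ENNReal.mul_rpow_of_nonneg _ (h x)
          (hq 0).symm.nonneg]
        rw [lintegral_mul_const _ (by fun_prop),
          ENNReal.mul_rpow_of_nonneg _ _ (one_div_nonneg.2 (hq 0).symm.nonneg),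
          ← ENNReal.rpow_mul (h x), mul_one_div_cancel (hq 0).symm.ne_zero, ENNReal.rpow_one]
        refine mul_le_of_le_one_left' ?_
        exact ENNReal.rpow_le_one h1 (one_div_nonneg.2 (hq 0).symm.nonneg)
      · rw [lintegral_cons (hf.fun_mul hgm)]
        refine lintegral_mono fun x => ?_
        have hFx : Measurable fun t : ℝ => F k (Fin.cons t x) :=
          (hFk.comp measurable_cons).comp measurable_prodMk_right
        have h1 := (exists_Lp_norming (G := G k x) (hq 0) hFx rfl (hGt k x)).1
        calc G k x * h x = ∫⁻ t : ℝ, F k (Fin.cons t x) *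
              (F k (Fin.cons t x) ^ (q 0 - 1) * (G k x ^ (q 0 - 1))⁻¹) * h x := by
              rw [lintegral_mul_const _ (by fun_prop), h1]
          _ ≤ _ := by
              refine lintegral_mono fun t => ?_
              simp only [Fin.tail_cons]
              rw [mul_assoc]
              exact mul_le_mul_left (hFf k _) _

end MixedNorm

theorem intervalMax_tsum_le (μ : Measure ℝ) {F : ℕ → ℝ → ℝ≥0∞} (hF : ∀ k, Measurable (F k))
    (x : ℝ) : intervalMax μ (fun y => ∑' k, F k y) x ≤ ∑' k, intervalMax μ (F k) x := by
  refine intervalMax_le fun I hI => ?_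
  rw [lintegral_tsum fun k => (hF k).aemeasurable, ← ENNReal.tsum_mul_left]
  exact ENNReal.tsum_le_tsum fun k => average_le_intervalMax μ (F k) hI

theorem intervalMax_const_mul_le (μ : Measure ℝ) (c : ℝ≥0∞) {f : ℝ → ℝ≥0∞} (hf : Measurable f)
    (x : ℝ) : intervalMax μ (fun y => c * f y) x ≤ c * intervalMax μ f x := by
  refine intervalMax_le fun I hI => ?_
  rw [lintegral_const_mul _ hf, mul_left_comm]
  gcongr
  exact average_le_intervalMax μ f hI

section PartialMax

variable {m : ℕ}

/-- The maximal operator over intervals in the `j`-th variable. -/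
def partialMax (j : Fin m) (f : (Fin m → ℝ) → ℝ≥0∞) (x : Fin m → ℝ) : ℝ≥0∞ :=
  intervalMax volume (fun t => f (Function.update x j t)) (x j)

theorem partialMax_insertNth (j : Fin (m + 1)) (f : (Fin (m + 1) → ℝ) → ℝ≥0∞) (t : ℝ)
    (z : Fin m → ℝ) : partialMax j f (j.insertNth t z) =
      intervalMax volume (fun s => f (j.insertNth s z)) t := by
  simp [partialMax]

theorem partialMax_zero_cons (f : (Fin (m + 1) → ℝ) → ℝ≥0∞) (t : ℝ) (x : Fin m → ℝ) :
    partialMax 0 f (Fin.cons t x) = intervalMax volume (fun s => f (Fin.cons s x)) t := by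
  simp [partialMax]

theorem partialMax_succ_cons (j : Fin m) (f : (Fin (m + 1) → ℝ) → ℝ≥0∞) (t : ℝ)
    (x : Fin m → ℝ) :
    partialMax j.succ f (Fin.cons t x) = partialMax j (fun y => f (Fin.cons t y)) x := by
  simp [partialMax, Fin.cons_update]

theorem isSublinear_partialMax (j : Fin m) : IsSublinear (partialMax j) where
  measurable f hf := by
    refine Measurable.iSup fun I => ?_
    have h1 : Measurable fun x : Fin m → ℝ => (volume (Ioo (I.1 : ℝ) I.2))⁻¹ *
        ∫⁻ t in Ioo (I.1 : ℝ) I.2, f (Function.update x j t) :=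
      (Measurable.lintegral_prod_right' (hf.comp measurable_update')).const_mul _
    exact h1.indicator (s := (fun x : Fin m → ℝ => x j) ⁻¹' Ioo (I.1 : ℝ) I.2)
      (measurable_pi_apply j measurableSet_Ioo)
  tsum_le F hF x := intervalMax_tsum_le _ (fun k => (hF k).comp (measurable_update x)) _
  const_mul_le c f hf x := intervalMax_const_mul_le _ c (hf.comp (measurable_update x)) _

theorem ae_ae_insertNth (j : Fin (m + 1)) {p : (Fin (m + 1) → ℝ) → Prop}
    (hp : MeasurableSet {y | p y}) (h : ∀ᵐ y, p y) :
    ∀ᵐ z : Fin m → ℝ, ∀ᵐ t : ℝ, p (j.insertNth t z) := by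
  have h1 := (volume_preserving_piFinSuccAbove
    (fun _ : Fin (m + 1) => ℝ) j).symm.quasiMeasurePreserving.ae h
  rw [Measure.volume_eq_prod] at h1
  exact (Measure.ae_ae_comm (p := fun (t : ℝ) (z : Fin m → ℝ) => p (j.insertNth t z))
    (measurable_insertNth j hp)).1 (Measure.ae_ae_of_ae_prod h1)

theorem exists_lintegral_partialMax_rpow_mul_weight_le {t : ℝ} {Λ : ℝ≥0∞} (ht : 1 < t)
    (hΛ0 : Λ ≠ 0) (hΛ : Λ ≠ ∞) (j : Fin m) :
    ∃ C : ℝ≥0∞, C ≠ ∞ ∧ ∀ u v : (Fin m → ℝ) → ℝ≥0∞, Measurable u → (∀ x, 0 < u x) →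
      (∀ᵐ x, u x < ∞) → (∀ x, partialMax j u x ≤ Λ * u x) → Measurable v → (∀ x, 0 < v x) →
      (∀ᵐ x, v x < ∞) → (∀ x, partialMax j v x ≤ Λ * v x) →
      ∀ f : (Fin m → ℝ) → ℝ≥0∞, Measurable f →
        ∫⁻ x, partialMax j f x ^ t * (u x ^ (1 - t) * v x) ≤
          C * ∫⁻ x, f x ^ t * (u x ^ (1 - t) * v x) := by
  obtain ⟨C, hC, h⟩ := exists_lintegral_intervalMax_rpow_mul_weight_le ht hΛ0 hΛ
  refine ⟨C, hC, fun u v hu hu0 hufin huA hv hv0 hvfin hvA f hf => ?_⟩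
  cases m with
  | zero => exact j.elim0
  | succ m =>
    have hMf := (isSublinear_partialMax j).measurable f hf
    have hins : ∀ z : Fin m → ℝ, Measurable fun t : ℝ => (j.insertNth t z : Fin (m + 1) → ℝ) :=
      fun z => (measurable_insertNth j).comp measurable_prodMk_right
    rw [lintegral_insertNth j (by fun_prop), lintegral_insertNth j (by fun_prop),
      ← lintegral_const_mul' _ _ hC]
    refine lintegral_mono_ae ?_
    filter_upwards [ae_ae_insertNth j (measurableSet_lt hu measurable_const) hufin,
      ae_ae_insertNth j (measurableSet_lt hv measurable_const) hvfin] with z hz1 hz2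
    simp only [partialMax_insertNth]
    refine h (fun t => u (j.insertNth t z)) (fun t => v (j.insertNth t z)) (hu.comp (hins z))
      (fun t => hu0 _) hz1 (fun t => ?_) (hv.comp (hins z)) (fun t => hv0 _) hz2 (fun t => ?_)
      (fun t => f (j.insertNth t z)) (hf.comp (hins z))
    · simpa only [partialMax_insertNth] using huA (j.insertNth t z)
    · simpa only [partialMax_insertNth] using hvA (j.insertNth t z)

end PartialMax

/-- Extrapolation from the weighted spaces `L^t(u ^ (1 - t) * v)` to a Köthe function space. -/
theorem IsKotheDual.extrapolation {Ω : Type*} [MeasurableSpace Ω] {μ : Measure Ω}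
    {N N' : (Ω → ℝ≥0∞) → ℝ≥0∞} (h : IsKotheDual μ N N') (h' : IsKotheDual μ N' N)
    {M : (Ω → ℝ≥0∞) → Ω → ℝ≥0∞} (hM : IsSublinear M) {A : ℝ≥0∞} (hA0 : A ≠ 0) (hA : A ≠ ∞)
    (hMN : ∀ f, Measurable f → N (M f) ≤ A * N f)
    (hMN' : ∀ f, Measurable f → N' (M f) ≤ A * N' f)
    {φ φ' : Ω → ℝ≥0∞} (hφ : Measurable φ) (hφ0 : ∀ x, 0 < φ x) (hφN : N φ ≤ 1)
    (hφ' : Measurable φ') (hφ'0 : ∀ x, 0 < φ' x) (hφ'N : N' φ' ≤ 1)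
    {t : ℝ} (ht : 1 < t) {C : ℝ≥0∞} (hC0 : C ≠ 0) (hC : C ≠ ∞) {F G : Ω → ℝ≥0∞}
    (hF : Measurable F) (hG : Measurable G)
    (hFG : ∀ u v : Ω → ℝ≥0∞, Measurable u → (∀ x, 0 < u x) →
      (∀ᵐ x ∂μ, u x < ∞) → (∀ x, M u x ≤ 2 * A * u x) → Measurable v → (∀ x, 0 < v x) →
      (∀ᵐ x ∂μ, v x < ∞) → (∀ x, M v x ≤ 2 * A * v x) →
      ∫⁻ x, F x ^ t * (u x ^ (1 - t) * v x) ∂μ ≤ C * ∫⁻ x, G x ^ t * (u x ^ (1 - t) * v x) ∂μ) :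
    N F ≤ C ^ (1 / t) * 8 * N G := by
  have ht0 : 0 < t := by linarith
  set K : ℝ≥0∞ := C ^ (1 / t) * 8 with hK
  have hC1 : C ^ (1 / t) ≠ ∞ := ENNReal.rpow_ne_top_of_nonneg (by positivity) hC
  have hK0 : K ≠ 0 := mul_ne_zero (ENNReal.rpow_pos hC0.bot_lt hC).ne' (by norm_num)
  have hKt : K ≠ ∞ := ENNReal.mul_ne_top hC1 (by norm_num)
  rcases eq_or_ne (N G) ∞ with hGt | hGt
  · rw [hGt, ENNReal.mul_top hK0]
    exact le_top
  refine h.le_of_forall_lintegral_le hF fun k hk hk1 => ?_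
  refine ENNReal.le_of_forall_pos_le_add fun δ hδ _ => ?_
  set ε : ℝ≥0∞ := δ / K with hε
  have hε0 : ε ≠ 0 := (ENNReal.div_pos (by exact_mod_cast hδ.ne') hKt).ne'
  have hεt : ε ≠ ∞ := ENNReal.div_ne_top ENNReal.coe_ne_top hK0
  have hg : Measurable fun x => G x + ε * φ x := by fun_prop
  have hk' : Measurable fun x => k x + φ' x := by fun_prop
  set u := rubioDeFrancia M A fun x => G x + ε * φ x with hu
  set v := rubioDeFrancia M A fun x => k x + φ' x with hv
  have hum : Measurable u := hM.measurable_rubioDeFrancia hg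
  have hvm : Measurable v := hM.measurable_rubioDeFrancia hk'
  have hGu : ∀ x, G x ≤ u x := fun x => le_self_add.trans (le_rubioDeFrancia M A _ x)
  have hkv : ∀ x, k x ≤ v x := fun x => le_self_add.trans (le_rubioDeFrancia M A _ x)
  have hu0 : ∀ x, 0 < u x := fun x => lt_of_lt_of_le
    (ENNReal.mul_pos hε0 (hφ0 x).ne') (le_add_self.trans (le_rubioDeFrancia M A _ x))
  have hv0 : ∀ x, 0 < v x := fun x =>
    (hφ'0 x).trans_le (le_add_self.trans (le_rubioDeFrancia M A _ x))
  have hNu : N u ≤ 2 * (N G + ε) := by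
    refine (hM.norm_rubioDeFrancia_le h hA0 hA hMN hg).trans ?_
    gcongr
    refine (h.add_le hG (by fun_prop)).trans ?_
    gcongr
    exact (h.const_mul_le ε hφ).trans (mul_le_of_le_one_right' hφN)
  have hNv : N' v ≤ 4 := by
    refine (hM.norm_rubioDeFrancia_le h' hA0 hA hMN' hk').trans ?_
    calc 2 * N' (fun x => k x + φ' x) ≤ 2 * (1 + 1) := by
          gcongr
          exact (h'.add_le hk hφ').trans (add_le_add hk1 hφ'N)
      _ = 4 := by norm_num
  have hNut : N u ≠ ∞ := ne_top_of_le_ne_top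
    (ENNReal.mul_ne_top ENNReal.ofNat_ne_top (ENNReal.add_ne_top.2 ⟨hGt, hεt⟩)) hNu
  have hufin := h.ae_lt_top hum hφ' hφ'0 (ne_top_of_le_ne_top one_ne_top hφ'N) hNut
  have hvfin := h'.ae_lt_top hvm hφ hφ0 (ne_top_of_le_ne_top one_ne_top hφN)
    (ne_top_of_le_ne_top ENNReal.ofNat_ne_top hNv)
  set t' := t / (t - 1) with ht'
  have htt : t.HolderConjugate t' := Real.HolderConjugate.conjExponent ht
  have ht'0 : 0 < t' := htt.symm.pos
  have huv : ∫⁻ x, u x * v x ∂μ ≤ 8 * (N G + ε) := by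
    refine (h.holder u v hum hvm).trans ?_
    calc N u * N' v ≤ 2 * (N G + ε) * 4 := by gcongr
      _ = 8 * (N G + ε) := by ring
  have hsplit : ∀ᵐ x ∂μ, F x * v x =
      (F x * (u x ^ (-(1 / t')) * v x ^ (1 / t))) * (u x * v x) ^ (1 / t') := by
    filter_upwards [hufin, hvfin] with x h1 h2
    rw [ENNReal.mul_rpow_of_ne_top h1.ne h2.ne]
    have e1 : u x ^ (-(1 / t')) * u x ^ (1 / t') = 1 := by
      rw [← ENNReal.rpow_add _ _ (hu0 x).ne' h1.ne, neg_add_cancel, ENNReal.rpow_zero]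
    have e2 : v x ^ (1 / t) * v x ^ (1 / t') = v x := by
      rw [← ENNReal.rpow_add _ _ (hv0 x).ne' h2.ne, one_div, one_div, htt.inv_add_inv_eq_one,
        ENNReal.rpow_one]
    calc F x * v x = F x * ((u x ^ (-(1 / t')) * u x ^ (1 / t')) *
          (v x ^ (1 / t) * v x ^ (1 / t'))) := by rw [e1, e2, one_mul]
      _ = _ := by ring
  have hpow : ∀ x, (F x * (u x ^ (-(1 / t')) * v x ^ (1 / t))) ^ t =
      F x ^ t * (u x ^ (1 - t) * v x) := by
    intro x
    rw [ENNReal.mul_rpow_of_nonneg _ _ ht0.le, ENNReal.mul_rpow_of_nonneg _ _ ht0.le,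
      ← ENNReal.rpow_mul, ← ENNReal.rpow_mul, one_div_mul_cancel ht0.ne', ENNReal.rpow_one]
    congr 3
    rw [ht']
    have : t - 1 ≠ 0 := by linarith
    field_simp
    ring
  have hGuv : ∀ᵐ x ∂μ, G x ^ t * (u x ^ (1 - t) * v x) ≤ u x * v x := by
    filter_upwards [hufin] with x h1
    calc G x ^ t * (u x ^ (1 - t) * v x) ≤ u x ^ t * (u x ^ (1 - t) * v x) := by
          gcongr
          exact hGu x
      _ = u x * v x := by
          rw [← mul_assoc, ← ENNReal.rpow_add _ _ (hu0 x).ne' h1.ne, add_sub_cancel,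
            ENNReal.rpow_one]
  calc ∫⁻ x, F x * k x ∂μ ≤ ∫⁻ x, F x * v x ∂μ := by
        refine lintegral_mono fun x => ?_
        gcongr
        exact hkv x
    _ = ∫⁻ x, (F x * (u x ^ (-(1 / t')) * v x ^ (1 / t))) * (u x * v x) ^ (1 / t') ∂μ :=
        lintegral_congr_ae hsplit
    _ ≤ (∫⁻ x, (F x * (u x ^ (-(1 / t')) * v x ^ (1 / t))) ^ t ∂μ) ^ (1 / t) *
          (∫⁻ x, ((u x * v x) ^ (1 / t')) ^ t' ∂μ) ^ (1 / t') :=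
        ENNReal.lintegral_mul_le_Lp_mul_Lq _ htt (by fun_prop) (by fun_prop)
    _ ≤ (C * ∫⁻ x, u x * v x ∂μ) ^ (1 / t) * (∫⁻ x, u x * v x ∂μ) ^ (1 / t') := by
        simp_rw [hpow, ← ENNReal.rpow_mul, one_div_mul_cancel ht'0.ne', ENNReal.rpow_one]
        gcongr
        refine (hFG u v hum hu0 hufin (hM.apply_rubioDeFrancia_le hA0 hA hg) hvm hv0 hvfin
          (hM.apply_rubioDeFrancia_le hA0 hA hk')).trans ?_
        gcongr 1
        exact lintegral_mono_ae hGuv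
    _ = C ^ (1 / t) * ∫⁻ x, u x * v x ∂μ := by
        rw [ENNReal.mul_rpow_of_nonneg _ _ (by positivity), mul_assoc,
          ← ENNReal.rpow_add_of_nonneg _ _ (by positivity) (by positivity), one_div t, one_div t',
          htt.inv_add_inv_eq_one, ENNReal.rpow_one]
    _ ≤ C ^ (1 / t) * (8 * (N G + ε)) := by gcongr
    _ = K * N G + K * ε := by rw [hK]; ring
    _ = K * N G + δ := by rw [hε, ENNReal.mul_div_cancel hK0 hKt]

section PartialMaxBounded

variable {m : ℕ}

theorem isKotheDual_mixedNormAux_conjExponent {q : Fin m → ℝ} (hq : ∀ i, 1 < q i) :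
    IsKotheDual volume (mixedNormAux m q) (mixedNormAux m fun i => (q i).conjExponent) :=
  isKotheDual_mixedNormAux fun i => Real.HolderConjugate.conjExponent (hq i)

theorem isKotheDual_mixedNormAux_conjExponent_left {q : Fin m → ℝ} (hq : ∀ i, 1 < q i) :
    IsKotheDual volume (mixedNormAux m fun i => (q i).conjExponent) (mixedNormAux m q) :=
  isKotheDual_mixedNormAux fun i => (Real.HolderConjugate.conjExponent (hq i)).symm

theorem exists_pos_mixedNormAux_le_one {q : Fin m → ℝ} (hq : ∀ i, 1 < q i) :
    ∃ φ : (Fin m → ℝ) → ℝ≥0∞, Measurable φ ∧ (∀ x, 0 < φ x) ∧ mixedNormAux m q φ ≤ 1 := by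
  refine (isKotheDual_mixedNormAux_conjExponent hq).exists_pos
    (E := fun k : ℕ => {x | ∀ i, x i ∈ Ioo (-(k : ℝ)) k}) (fun k => ?_) (fun x => ?_) fun k => ?_
  · exact measurableSet_setOfPred.2 (Measurable.forall fun i =>
      measurableSet_setOfPred.1 (measurable_pi_apply i measurableSet_Ioo))
  · obtain ⟨k, hk⟩ := exists_nat_gt (∑ i, |x i|)
    refine ⟨k, fun i => abs_lt.1 (lt_of_le_of_lt ?_ hk)⟩
    exact Finset.single_le_sum (f := fun i => |x i|) (fun _ _ => abs_nonneg _) (Finset.mem_univ i)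
  · have h := mixedNormAux_box (fun i => zero_lt_one.trans (hq i)) (k : ℝ) 1
    change mixedNormAux m q ({x | ∀ i, x i ∈ Ioo (-(k : ℝ)) k}.indicator fun _ => 1) ≠ ∞
    rw [h, one_mul]
    exact ENNReal.rpow_ne_top_of_nonneg (Finset.sum_nonneg fun i _ =>
      one_div_nonneg.2 (zero_le_one.trans (hq i).le)) ENNReal.ofReal_ne_top

theorem innerNorm_rpow {q : ℝ} (hq : 0 < q) (f : (Fin (m + 1) → ℝ) → ℝ≥0∞) (x : Fin m → ℝ) :
    innerNorm q f x ^ q = ∫⁻ t : ℝ, f (Fin.cons t x) ^ q := by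
  rw [innerNorm, ← ENNReal.rpow_mul, one_div_mul_cancel hq.ne', ENNReal.rpow_one]

theorem lintegral_innerNorm_rpow_mul {q : ℝ} (hq : 0 < q) {f : (Fin (m + 1) → ℝ) → ℝ≥0∞}
    (hf : Measurable f) {w : (Fin m → ℝ) → ℝ≥0∞} (hw : Measurable w) :
    ∫⁻ x, innerNorm q f x ^ q * w x = ∫⁻ t : ℝ, ∫⁻ x, f (Fin.cons t x) ^ q * w x := by
  have hf' : Measurable fun p : ℝ × (Fin m → ℝ) => f (Fin.cons p.1 p.2) :=
    hf.comp measurable_cons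
  rw [lintegral_lintegral_swap (f := fun (t : ℝ) x => f (Fin.cons t x) ^ q * w x)
    (Measurable.aemeasurable (by fun_prop))]
  refine lintegral_congr fun x => ?_
  have hfx : Measurable fun t : ℝ => f (Fin.cons t x) := hf'.comp measurable_prodMk_right
  rw [lintegral_mul_const _ (by fun_prop), innerNorm_rpow hq]

/-- The partial maximal operators are bounded on mixed-norm spaces. -/
theorem exists_mixedNormAux_partialMax_le {q : Fin m → ℝ} (hq : ∀ i, 1 < q i) (j : Fin m) :
    ∃ C : ℝ≥0∞, C ≠ ∞ ∧ ∀ f : (Fin m → ℝ) → ℝ≥0∞, Measurable f →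
      mixedNormAux m q (partialMax j f) ≤ C * mixedNormAux m q f := by
  induction m with
  | zero => exact j.elim0
  | succ m ih =>
    have hqt : ∀ i : Fin m, 1 < q i.succ := fun i => hq i.succ
    have hq0 : 0 < q 0 := zero_lt_one.trans (hq 0)
    have hK := isKotheDual_mixedNormAux_conjExponent hqt
    have hK' := isKotheDual_mixedNormAux_conjExponent_left hqt
    refine Fin.cases ?_ (fun j => ?_) j
    · set B : ℝ≥0∞ := ENNReal.ofReal (q 0) * (4 * ((ENNReal.ofReal (q 0 - 1))⁻¹ *
        2 ^ (q 0 - 1))) with hB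
      have hBt : B ≠ ∞ :=
        ENNReal.mul_ne_top ENNReal.ofReal_ne_top (ENNReal.mul_ne_top ENNReal.ofNat_ne_top
          (ENNReal.mul_ne_top (ENNReal.inv_ne_top.2 (by simpa using hq 0))
            (ENNReal.rpow_ne_top_of_nonneg (by linarith [hq 0]) ENNReal.ofNat_ne_top)))
      refine ⟨B ^ (1 / q 0), ENNReal.rpow_ne_top_of_nonneg (by positivity) hBt, fun f hf => ?_⟩
      rw [mixedNormAux_succ, mixedNormAux_succ]
      refine (mixedNormAux_mono _ (fun i => (zero_lt_one.trans (hqt i)).le) fun x => ?_).trans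
        (hK.const_mul_le (B ^ (1 / q 0)) (measurable_innerNorm (q 0) hf))
      have hfx : Measurable fun t : ℝ => f (Fin.cons t x) :=
        (hf.comp measurable_cons).comp measurable_prodMk_right
      have h := lintegral_intervalMax_rpow_le volume (hq 0) hfx
      simp only [innerNorm, partialMax_zero_cons]
      rw [← ENNReal.mul_rpow_of_nonneg _ _ (one_div_nonneg.2 hq0.le)]
      gcongr
    · obtain ⟨C₁, hC₁, h₁⟩ := ih hqt j
      obtain ⟨C₂, hC₂, h₂⟩ := ih (q := fun i : Fin m => (q i.succ).conjExponent)
        (fun i => (Real.HolderConjugate.conjExponent (hqt i)).symm.lt) j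
      obtain ⟨φ, hφ, hφ0, hφN⟩ := exists_pos_mixedNormAux_le_one hqt
      obtain ⟨φ', hφ', hφ'0, hφ'N⟩ := exists_pos_mixedNormAux_le_one
        (q := fun i : Fin m => (q i.succ).conjExponent)
        (fun i => (Real.HolderConjugate.conjExponent (hqt i)).symm.lt)
      set A : ℝ≥0∞ := C₁ + C₂ + 1 with hA
      have hA0 : A ≠ 0 := by simp [hA]
      have hAt : A ≠ ∞ := by simp [hA, hC₁, hC₂]
      obtain ⟨C, hC, hw⟩ := exists_lintegral_partialMax_rpow_mul_weight_le (hq 0)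
        (mul_ne_zero two_ne_zero hA0) (ENNReal.mul_ne_top ENNReal.ofNat_ne_top hAt) j
      refine ⟨(C + 1) ^ (1 / q 0) * 8, ENNReal.mul_ne_top (ENNReal.rpow_ne_top_of_nonneg
        (by positivity) (by simp [hC])) (by norm_num), fun f hf => ?_⟩
      rw [mixedNormAux_succ, mixedNormAux_succ]
      have hMf := (isSublinear_partialMax j.succ).measurable f hf
      refine hK.extrapolation hK' (isSublinear_partialMax j) hA0 hAt
        (fun g hg => (h₁ g hg).trans ?_) (fun g hg => (h₂ g hg).trans ?_) hφ hφ0 hφN hφ' hφ'0 hφ'N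
        (hq 0) (C := C + 1) (by simp) (by simp [hC]) (measurable_innerNorm _ hMf)
        (measurable_innerNorm _ hf) fun u v hu hu0 hufin huA hv hv0 hvfin hvA => ?_
      · gcongr
        rw [hA, add_assoc]
        exact le_self_add
      · gcongr
        rw [hA, add_comm C₁, add_assoc]
        exact le_self_add
      · rw [lintegral_innerNorm_rpow_mul hq0 hMf (by fun_prop),
          lintegral_innerNorm_rpow_mul hq0 hf (by fun_prop)]
        rw [← lintegral_const_mul' _ _ (by simp [hC])]
        refine lintegral_mono fun t => ?_
        simp only [partialMax_succ_cons]
        have hft : Measurable fun x : Fin m → ℝ => f (Fin.cons t x) :=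
          (hf.comp measurable_cons).comp measurable_prodMk_left
        refine (hw u v hu hu0 hufin huA hv hv0 hvfin hvA _ hft).trans ?_
        gcongr
        exact le_self_add

end PartialMaxBounded

section IteratedMax

variable {m : ℕ}

/-- The composition of the maximal operators in the variables listed in `l`. -/
def iteratedMax (l : List (Fin m)) (f : (Fin m → ℝ) → ℝ≥0∞) : (Fin m → ℝ) → ℝ≥0∞ :=
  l.foldr partialMax f

theorem iteratedMax_cons (j : Fin m) (l : List (Fin m)) (f : (Fin m → ℝ) → ℝ≥0∞) :
    iteratedMax (j :: l) f = partialMax j (iteratedMax l f) := rfl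

theorem measurable_iteratedMax (l : List (Fin m)) {f : (Fin m → ℝ) → ℝ≥0∞} (hf : Measurable f) :
    Measurable (iteratedMax l f) := by
  induction l with
  | nil => exact hf
  | cons j l ih => exact (isSublinear_partialMax j).measurable _ ih

theorem exists_mixedNormAux_iteratedMax_le {q : Fin m → ℝ} (hq : ∀ i, 1 < q i)
    (l : List (Fin m)) : ∃ C : ℝ≥0∞, C ≠ ∞ ∧ ∀ f : (Fin m → ℝ) → ℝ≥0∞, Measurable f →
      mixedNormAux m q (iteratedMax l f) ≤ C * mixedNormAux m q f := by
  induction l with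
  | nil => exact ⟨1, one_ne_top, fun f _ => by rw [one_mul]; rfl⟩
  | cons j l ih =>
    obtain ⟨C, hC, h⟩ := ih
    obtain ⟨C', hC', h'⟩ := exists_mixedNormAux_partialMax_le hq j
    refine ⟨C' * C, ENNReal.mul_ne_top hC' hC, fun f hf => ?_⟩
    rw [iteratedMax_cons, mul_assoc]
    refine (h' _ (measurable_iteratedMax l hf)).trans ?_
    gcongr
    exact h f hf

theorem prod_mul_lmarginal_le_iteratedMax {f : (Fin m → ℝ) → ℝ≥0∞} (hf : Measurable f)
    (I : Fin m → ℚ × ℚ) {l : List (Fin m)} (hl : l.Nodup) {x : Fin m → ℝ}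
    (hx : ∀ i ∈ l, x i ∈ Ioo ((I i).1 : ℝ) (I i).2) :
    (∏ i ∈ l.toFinset, (volume (Ioo ((I i).1 : ℝ) (I i).2))⁻¹) *
        (∫⋯∫⁻_l.toFinset, f ∂fun i => volume.restrict (Ioo ((I i).1 : ℝ) (I i).2)) x ≤
      iteratedMax l f x := by
  induction l generalizing x with
  | nil => simp [iteratedMax]
  | cons j l ih =>
    obtain ⟨hj, hl⟩ := List.nodup_cons.1 hl
    have hj' : j ∉ l.toFinset := by simpa using hj
    have hmeas : Measurable fun t => (∫⋯∫⁻_l.toFinset, f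
        ∂fun i => volume.restrict (Ioo ((I i).1 : ℝ) (I i).2)) (Function.update x j t) :=
      (hf.lmarginal _).comp (measurable_update x)
    rw [List.toFinset_cons, Finset.prod_insert hj', lmarginal_insert _ hf hj', iteratedMax_cons,
      mul_assoc, ← lintegral_const_mul _ hmeas]
    refine le_trans ?_ (average_le_intervalMax volume
      (fun t => iteratedMax l f (Function.update x j t)) (hx j List.mem_cons_self))
    gcongr with t
    refine ih hl fun i hi => ?_
    rw [Function.update_of_ne (ne_of_mem_of_not_mem hi hj)]
    exact hx i (List.mem_cons_of_mem j hi)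

theorem setLIntegral_pi_Ioo_le_iteratedMax {f : (Fin m → ℝ) → ℝ≥0∞} (hf : Measurable f)
    (I : Fin m → ℚ × ℚ) {x : Fin m → ℝ} (hx : ∀ i, x i ∈ Ioo ((I i).1 : ℝ) (I i).2) :
    (∏ i, (volume (Ioo ((I i).1 : ℝ) (I i).2))⁻¹) *
        ∫⁻ y in Set.univ.pi fun i => Ioo ((I i).1 : ℝ) (I i).2, f y ≤
      iteratedMax (List.finRange m) f x := by
  have h := prod_mul_lmarginal_le_iteratedMax hf I (List.nodup_finRange m) fun i _ => hx i
  rwa [List.toFinset_finRange, lmarginal_univ, ← Measure.restrict_pi_pi] at h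

theorem setLIntegral_pi_Ioo_sub_add_le_iteratedMax {f : (Fin m → ℝ) → ℝ≥0∞}
    (hf : Measurable f) {c x : Fin m → ℝ} {r : ℝ} (hr : 0 < r)
    (hx : ∀ i, x i ∈ Ioo (c i - r) (c i + r)) :
    ∫⁻ y in Set.univ.pi fun i => Ioo (c i - r) (c i + r), f y ≤
      ENNReal.ofReal (4 * r) ^ m * iteratedMax (List.finRange m) f x := by
  have h1 : ∀ i, ∃ a : ℚ, c i - 2 * r < a ∧ (a : ℝ) < c i - r := fun i =>
    exists_rat_btwn (by linarith)
  have h2 : ∀ i, ∃ b : ℚ, c i + r < b ∧ (b : ℝ) < c i + 2 * r := fun i =>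
    exists_rat_btwn (by linarith)
  choose a ha1 ha2 using h1
  choose b hb1 hb2 using h2
  have h := setLIntegral_pi_Ioo_le_iteratedMax hf (fun i => (a i, b i)) (x := x) fun i =>
    ⟨(ha2 i).trans (hx i).1, (hx i).2.trans (hb1 i)⟩
  have hvol : ∀ i, (ENNReal.ofReal (4 * r))⁻¹ ≤ (volume (Ioo (a i : ℝ) (b i)))⁻¹ := fun i => by
    rw [ENNReal.inv_le_inv, Real.volume_Ioo]
    exact ENNReal.ofReal_le_ofReal (by linarith [ha1 i, hb2 i])
  have hp : ((ENNReal.ofReal (4 * r)) ^ m)⁻¹ ≤ ∏ i, (volume (Ioo (a i : ℝ) (b i)))⁻¹ := by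
    refine le_trans (le_of_eq ?_) (Finset.prod_le_prod' fun i _ => hvol i)
    simp [ENNReal.inv_pow]
  have hp0 : ENNReal.ofReal (4 * r) ^ m ≠ 0 := pow_ne_zero _ (by simpa using hr)
  rw [← ENNReal.inv_mul_le_iff hp0 (by finiteness)]
  refine le_trans ?_ h
  gcongr with i
  · exact (ha2 i).le
  · exact (hb1 i).le

end IteratedMax

section MaximalFn

variable {n : ℕ}

theorem IsKotheDual.comp_measurableEquiv {Ω Ω' : Type*} [MeasurableSpace Ω] [MeasurableSpace Ω']
    {μ : Measure Ω} {ν : Measure Ω'} {N N' : (Ω → ℝ≥0∞) → ℝ≥0∞} (h : IsKotheDual μ N N')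
    (e : Ω ≃ᵐ Ω') (he : MeasurePreserving e μ ν) :
    IsKotheDual ν (fun f => N (f ∘ e)) (fun f => N' (f ∘ e)) where
  holder f g hf hg := by
    rw [← he.lintegral_comp (hf.fun_mul hg)]
    exact h.holder _ _ (hf.comp e.measurable) (hg.comp e.measurable)
  norming f hf c hc := by
    obtain ⟨g, hg, hg1, hcg⟩ := h.norming _ (hf.comp e.measurable) c hc
    refine ⟨g ∘ e.symm, hg.comp e.symm.measurable, ?_, ?_⟩
    · simpa [Function.comp_assoc] using hg1
    · rw [← he.lintegral_comp (hf.fun_mul (hg.comp e.symm.measurable))]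
      simpa using hcg

theorem mixedNorm_eq (q : Fin n → ℝ) (f : Euc n → ℝ≥0∞) :
    mixedNorm q f = mixedNormAux n q (f ∘ MeasurableEquiv.toLp 2 (Fin n → ℝ)) := rfl

theorem isKotheDual_mixedNorm_conjExponent {q : Fin n → ℝ} (hq : ∀ i, 1 < q i) :
    IsKotheDual volume (mixedNorm q) (mixedNorm fun i => (q i).conjExponent) :=
  (isKotheDual_mixedNormAux_conjExponent hq).comp_measurableEquiv
    (MeasurableEquiv.toLp 2 (Fin n → ℝ)) (PiLp.volume_preserving_toLp (Fin n))

theorem isKotheDual_mixedNorm_conjExponent_left {q : Fin n → ℝ} (hq : ∀ i, 1 < q i) :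
    IsKotheDual volume (mixedNorm fun i => (q i).conjExponent) (mixedNorm q) :=
  (isKotheDual_mixedNormAux_conjExponent_left hq).comp_measurableEquiv
    (MeasurableEquiv.toLp 2 (Fin n → ℝ)) (PiLp.volume_preserving_toLp (Fin n))

theorem average_le_maximalFn (f : Euc n → ℝ≥0∞) {x c : Euc n} {r : ℝ} (hr : 0 < r)
    (hx : x ∈ Metric.ball c r) :
    (volume (Metric.ball c r))⁻¹ * ∫⁻ y in Metric.ball c r, f y ≤ maximalFn f x :=
  le_iSup_of_le c (le_iSup_of_le r (le_iSup_of_le hr (le_iSup_of_le hx le_rfl)))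

theorem maximalFn_le {f : Euc n → ℝ≥0∞} {x : Euc n} {B : ℝ≥0∞}
    (h : ∀ (c : Euc n) (r : ℝ), 0 < r → x ∈ Metric.ball c r →
      (volume (Metric.ball c r))⁻¹ * ∫⁻ y in Metric.ball c r, f y ≤ B) : maximalFn f x ≤ B :=
  iSup_le fun c => iSup_le fun r => iSup_le fun hr => iSup_le fun hx => h c r hr hx

theorem measurable_maximalFn (f : Euc n → ℝ≥0∞) : Measurable (maximalFn f) := by
  refine LowerSemicontinuous.measurable ?_
  have h : maximalFn f = fun x => ⨆ (c : Euc n) (r : ℝ) (_ : 0 < r),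
      (Metric.ball c r).indicator
        (fun _ => (volume (Metric.ball c r))⁻¹ * ∫⁻ y in Metric.ball c r, f y) x := by
    ext x
    simp only [maximalFn, indicator]
    congr! with c r hr
    split_ifs with hx <;> simp [hx]
  rw [h]
  exact lowerSemicontinuous_iSup fun c => lowerSemicontinuous_iSup fun r =>
    lowerSemicontinuous_iSup fun hr => Metric.isOpen_ball.lowerSemicontinuous_indicator zero_le

theorem isSublinear_maximalFn : IsSublinear (maximalFn (n := n)) where
  measurable f _ := measurable_maximalFn f
  tsum_le F hF x := by
    refine maximalFn_le fun c r hr hx => ?_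
    rw [lintegral_tsum fun k => (hF k).aemeasurable, ← ENNReal.tsum_mul_left]
    exact ENNReal.tsum_le_tsum fun k => average_le_maximalFn (F k) hr hx
  const_mul_le c f hf x := by
    refine maximalFn_le fun y r hr hx => ?_
    rw [lintegral_const_mul _ hf, mul_left_comm]
    gcongr
    exact average_le_maximalFn f hr hx

theorem volume_ball_eq (c : Euc n) {r : ℝ} (hr : 0 < r) : volume (Metric.ball c r) =
    ENNReal.ofReal r ^ n * volume (Metric.ball (0 : Euc n) 1) := by
  rw [Measure.addHaar_ball_of_pos _ _ hr, finrank_euclideanSpace_fin, ENNReal.ofReal_pow hr.le]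

theorem maximalFn_le_iteratedMax {f : Euc n → ℝ≥0∞} (hf : Measurable f) (x : Euc n) :
    maximalFn f x ≤ 4 ^ n * (volume (Metric.ball (0 : Euc n) 1))⁻¹ *
      iteratedMax (List.finRange n) (f ∘ MeasurableEquiv.toLp 2 (Fin n → ℝ))
        ((MeasurableEquiv.toLp 2 (Fin n → ℝ)).symm x) := by
  set e := MeasurableEquiv.toLp 2 (Fin n → ℝ) with he
  refine maximalFn_le fun c r hr hx => ?_
  have hsub : ∀ y ∈ Metric.ball c r, ∀ i, y i ∈ Ioo (c i - r) (c i + r) := fun y hy i => by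
    have h1 : ‖(y - c) i‖ < r := (PiLp.norm_apply_le (y - c) i).trans_lt (mem_ball_iff_norm.1 hy)
    rw [PiLp.sub_apply, Real.norm_eq_abs, abs_lt] at h1
    constructor <;> linarith [h1.1, h1.2]
  have h1 : ∫⁻ y in Metric.ball c r, f y ≤
      ∫⁻ y in Set.univ.pi fun i => Ioo (c i - r) (c i + r), (f ∘ e) y := by
    rw [← (PiLp.volume_preserving_toLp (Fin n)).setLIntegral_comp_preimage_emb
      e.measurableEmbedding]
    exact lintegral_mono_set fun y hy i _ => hsub _ hy i
  have h2 := h1.trans (setLIntegral_pi_Ioo_sub_add_le_iteratedMax (hf.comp e.measurable) hr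
    (x := e.symm x) (hsub x hx))
  have hr0 : ENNReal.ofReal r ^ n ≠ 0 := pow_ne_zero _ (by simpa using hr)
  calc (volume (Metric.ball c r))⁻¹ * ∫⁻ y in Metric.ball c r, f y
      ≤ (ENNReal.ofReal r ^ n * volume (Metric.ball (0 : Euc n) 1))⁻¹ *
        (ENNReal.ofReal (4 * r) ^ n * iteratedMax (List.finRange n) (f ∘ e) (e.symm x)) := by
        rw [volume_ball_eq c hr]
        gcongr
    _ = ((ENNReal.ofReal r ^ n)⁻¹ * ENNReal.ofReal r ^ n) *
        (4 ^ n * (volume (Metric.ball (0 : Euc n) 1))⁻¹ *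
          iteratedMax (List.finRange n) (f ∘ e) (e.symm x)) := by
        rw [ENNReal.mul_inv (.inl hr0) (.inl (by finiteness)),
          ENNReal.ofReal_mul zero_le_four, mul_pow, ENNReal.ofReal_ofNat]
        ring
    _ = _ := by rw [ENNReal.inv_mul_cancel hr0 (by finiteness), one_mul]

theorem exists_mixedNorm_maximalFn_le {q : Fin n → ℝ} (hq : ∀ i, 1 < q i) :
    ∃ C : ℝ≥0∞, C ≠ ∞ ∧ ∀ f : Euc n → ℝ≥0∞, Measurable f →
      mixedNorm q (maximalFn f) ≤ C * mixedNorm q f := by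
  obtain ⟨C, hC, h⟩ := exists_mixedNormAux_iteratedMax_le hq (List.finRange n)
  have hV : (volume (Metric.ball (0 : Euc n) 1))⁻¹ ≠ ∞ :=
    ENNReal.inv_ne_top.2 (Metric.measure_ball_pos _ _ one_pos).ne'
  refine ⟨4 ^ n * (volume (Metric.ball (0 : Euc n) 1))⁻¹ * C, by finiteness, fun f hf => ?_⟩
  set e := MeasurableEquiv.toLp 2 (Fin n → ℝ) with he
  have hm := measurable_iteratedMax (List.finRange n) (hf.comp e.measurable)
  rw [mixedNorm_eq, mixedNorm_eq, mul_assoc]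
  refine le_trans (mixedNormAux_mono q (fun i => by linarith [hq i]) fun x => ?_)
    (((isKotheDual_mixedNormAux_conjExponent hq).const_mul_le _ hm).trans
      (mul_le_mul_right (h _ (hf.comp e.measurable)) _))
  exact maximalFn_le_iteratedMax hf (e x)

end MaximalFn

theorem exists_tsum_rpow_le_one_lt_tsum_mul {ι : Type*} {p p' : ℝ} (hp : p.HolderConjugate p')
    {a : ι → ℝ≥0∞} {c : ℝ≥0∞} (hc : c < (∑' k, a k ^ p) ^ (1 / p)) :
    ∃ b : ι → ℝ≥0∞, ∑' k, b k ^ p' ≤ 1 ∧ c < ∑' k, a k * b k := by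
  classical
  by_cases ha : ∃ k, a k = ∞
  · obtain ⟨k, hk⟩ := ha
    refine ⟨Pi.single k 1, ?_, ?_⟩
    · rw [tsum_eq_single k fun j hj => by simp [hj, hp.symm.pos]]
      simp
    · rw [tsum_eq_single k fun j hj => by simp [hj]]
      simpa [hk] using hc.trans_le le_top
  push Not at ha
  have hcp : c ^ p < ∑' k, a k ^ p := by
    have := ENNReal.rpow_lt_rpow hc hp.pos
    rwa [← ENNReal.rpow_mul, one_div_mul_cancel hp.ne_zero, ENNReal.rpow_one] at this
  rw [ENNReal.tsum_eq_iSup_sum, lt_iSup_iff] at hcp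
  obtain ⟨s, hs⟩ := hcp
  let _ : MeasurableSpace ι := ⊤
  set F : ι → ℝ≥0∞ := fun k => if k ∈ s then a k else 0 with hF
  have hFs : ∑' k, F k ^ p = ∑ k ∈ s, a k ^ p := by
    rw [tsum_eq_sum (s := s) fun k hk => by simp [hF, hk, hp.pos]]
    exact Finset.sum_congr rfl fun k hk => by simp [hF, hk]
  set G := (∫⁻ k, F k ^ p ∂Measure.count) ^ (1 / p) with hG
  have hGs : G = (∑ k ∈ s, a k ^ p) ^ (1 / p) := by rw [hG, lintegral_count, hFs]
  have hGt : G ≠ ∞ := by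
    rw [hGs]
    exact ENNReal.rpow_ne_top_of_nonneg (one_div_nonneg.2 hp.nonneg)
      (ENNReal.sum_ne_top.2 fun k _ => ENNReal.rpow_ne_top_of_nonneg hp.nonneg (ha k))
  obtain ⟨h1, h2⟩ := exists_Lp_norming hp (measurable_from_top (f := F)) hG hGt
  rw [lintegral_count] at h1 h2
  refine ⟨_, h2, ?_⟩
  calc c = (c ^ p) ^ (1 / p) := by
        rw [← ENNReal.rpow_mul, mul_one_div_cancel hp.ne_zero, ENNReal.rpow_one]
    _ < G := by
        rw [hGs]
        exact ENNReal.rpow_lt_rpow hs (one_div_pos.2 hp.pos)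
    _ ≤ _ := by
        refine h1.ge.trans (ENNReal.tsum_le_tsum fun k => mul_le_mul_left ?_ _)
        simp only [hF]
        split_ifs <;> simp

theorem tsum_mul_le_rpow_tsum_mul_rpow_tsum {ι : Type*} {p p' : ℝ} (hp : p.HolderConjugate p')
    (a b : ι → ℝ≥0∞) :
    ∑' k, a k * b k ≤ (∑' k, a k ^ p) ^ (1 / p) * (∑' k, b k ^ p') ^ (1 / p') := by
  let _ : MeasurableSpace ι := ⊤
  simpa only [lintegral_count, Pi.mul_apply] using ENNReal.lintegral_mul_le_Lp_mul_Lq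
    Measure.count hp (f := a) (g := b) measurable_from_top.aemeasurable
    measurable_from_top.aemeasurable

theorem IsKotheDual.exists_seq_tendsto {Ω : Type*} [MeasurableSpace Ω] {μ : Measure Ω}
    {N N' : (Ω → ℝ≥0∞) → ℝ≥0∞} (h : IsKotheDual μ N N') (h' : IsKotheDual μ N' N)
    {f : Ω → ℝ≥0∞} (hf : Measurable f) :
    ∃ g : ℕ → Ω → ℝ≥0∞, (∀ m, Measurable (g m)) ∧ (∀ m, N' (g m) ≤ 1) ∧
      Tendsto (fun m => ∫⁻ x, f x * g m x ∂μ) atTop (𝓝 (N f)) := by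
  set S : Set ℝ≥0∞ := {y | ∃ g : Ω → ℝ≥0∞, (Measurable g ∧ N' g ≤ 1) ∧ ∫⁻ x, f x * g x ∂μ = y}
    with hS
  have hSne : S.Nonempty := ⟨_, fun _ => 0, ⟨measurable_const, by simp [h'.zero]⟩, rfl⟩
  have hsup : sSup S = N f := by
    refine le_antisymm (sSup_le ?_) (h.le_of_forall_lintegral_le hf fun g hg hg1 =>
      le_sSup ⟨g, ⟨hg, hg1⟩, rfl⟩)
    rintro _ ⟨g, ⟨hg, hg1⟩, rfl⟩
    exact h.lintegral_le hf hg hg1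
  obtain ⟨u, -, hu, huS⟩ := exists_seq_tendsto_sSup hSne (OrderTop.bddAbove S)
  choose g hg hgu using huS
  refine ⟨g, fun m => (hg m).1, fun m => (hg m).2, ?_⟩
  simpa only [hgu, hsup] using hu

section Annulus

variable {n : ℕ}

theorem mem_annulus {k : ℤ} {x : Euc n} :
    x ∈ annulus n k ↔ (2 : ℝ) ^ (k - 1) ≤ ‖x‖ ∧ ‖x‖ < 2 ^ k := by
  simp [annulus, and_comm]

theorem measurableSet_annulus (k : ℤ) : MeasurableSet (annulus n k) :=
  Metric.isOpen_ball.measurableSet.diff Metric.isOpen_ball.measurableSet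

theorem exists_mem_annulus {x : Euc n} (hx : x ≠ 0) : ∃ k, x ∈ annulus n k := by
  obtain ⟨k, hk⟩ := exists_mem_Ico_zpow (norm_pos_iff.2 hx) one_lt_two
  exact ⟨k + 1, mem_annulus.2 ⟨by simpa using hk.1, hk.2⟩⟩

theorem eq_of_mem_annulus {x : Euc n} {j k : ℤ} (hj : x ∈ annulus n j) (hk : x ∈ annulus n k) :
    j = k := by
  rw [mem_annulus] at hj hk
  have h1 := (zpow_lt_zpow_iff_right₀ (one_lt_two (α := ℝ))).1 (hj.1.trans_lt hk.2)
  have h2 := (zpow_lt_zpow_iff_right₀ (one_lt_two (α := ℝ))).1 (hk.1.trans_lt hj.2)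
  omega

theorem tsum_indicator_annulus (F : ℤ → Euc n → ℝ≥0∞) {x : Euc n} {k : ℤ} (hx : x ∈ annulus n k) :
    ∑' j, (annulus n j).indicator (F j) x = F k x := by
  rw [tsum_eq_single k fun j hj => indicator_of_notMem (fun h => hj (eq_of_mem_annulus h hx)) _,
    indicator_of_mem hx]

theorem ae_eq_tsum_indicator_annulus [NeZero n] (f : Euc n → ℝ≥0∞) :
    ∀ᵐ x, f x = ∑' k, (annulus n k).indicator f x := by
  filter_upwards [Measure.ae_ne volume (0 : Euc n)] with x hx
  obtain ⟨k, hk⟩ := exists_mem_annulus hx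
  exact (tsum_indicator_annulus (fun _ => f) hk).symm

theorem lintegral_eq_tsum_annulus [NeZero n] {f : Euc n → ℝ≥0∞} (hf : Measurable f) :
    ∫⁻ x, f x = ∑' k, ∫⁻ x, (annulus n k).indicator f x := by
  rw [lintegral_congr_ae (ae_eq_tsum_indicator_annulus f),
    lintegral_tsum fun k => (hf.indicator (measurableSet_annulus k)).aemeasurable]

end Annulus

section Herz

variable {n : ℕ}

theorem herzNorm_eq {P : ℝ} (hP : 0 ≤ P) (N : (Euc n → ℝ≥0∞) → ℝ≥0∞) (β : ℝ)
    (f : Euc n → ℝ≥0∞) : herzNorm N β P f =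
      (∑' k : ℤ, ((2 : ℝ≥0∞) ^ (k * β) * N ((annulus n k).indicator f)) ^ P) ^ (1 / P) := by
  rw [herzNorm]
  congr 1
  refine tsum_congr fun k => ?_
  rw [ENNReal.mul_rpow_of_nonneg _ _ hP, ← ENNReal.rpow_mul]
  congr 2
  ring

theorem two_rpow_mul_two_rpow_neg (b : ℝ) : (2 : ℝ≥0∞) ^ b * 2 ^ (-b) = 1 := by
  rw [← ENNReal.rpow_add _ _ two_ne_zero ENNReal.ofNat_ne_top, add_neg_cancel, ENNReal.rpow_zero]

theorem IsKotheDual.herzNorm [NeZero n] {N N' : (Euc n → ℝ≥0∞) → ℝ≥0∞}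
    (h : IsKotheDual volume N N') (h' : IsKotheDual volume N' N) {P P' : ℝ}
    (hP : P.HolderConjugate P') (β : ℝ) :
    IsKotheDual volume (herzNorm N β P) (herzNorm N' (-β) P') where
  holder f g hf hg := by
    rw [herzNorm_eq hP.nonneg, herzNorm_eq hP.symm.nonneg,
      lintegral_eq_tsum_annulus (hf.fun_mul hg)]
    refine le_trans (ENNReal.tsum_le_tsum fun k => ?_) (tsum_mul_le_rpow_tsum_mul_rpow_tsum hP _ _)
    have e : (annulus n k).indicator (fun x => f x * g x) =
        fun x => (annulus n k).indicator f x * (annulus n k).indicator g x := by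
      ext x
      by_cases hx : x ∈ annulus n k <;> simp [hx]
    rw [e, mul_mul_mul_comm, mul_neg, two_rpow_mul_two_rpow_neg, one_mul]
    exact h.holder _ _ (hf.indicator (measurableSet_annulus k))
      (hg.indicator (measurableSet_annulus k))
  norming f hf c hc := by
    rw [herzNorm_eq hP.nonneg] at hc
    obtain ⟨b, hb1, hcb⟩ := exists_tsum_rpow_le_one_lt_tsum_mul hP hc
    have hbt : ∀ k, b k ≠ ∞ := fun k hk => by
      have := (ENNReal.le_tsum k).trans hb1
      rw [hk, ENNReal.top_rpow_of_pos hP.symm.pos] at this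
      exact absurd this (by simp)
    rw [ENNReal.tsum_eq_iSup_sum, lt_iSup_iff] at hcb
    obtain ⟨s, hs⟩ := hcb
    have hfk : ∀ k, Measurable ((annulus n k).indicator f) := fun k =>
      hf.indicator (measurableSet_annulus k)
    choose u hum hu1 hu using fun k => h.exists_seq_tendsto h' (hfk k)
    have hlim : Tendsto (fun m => ∑ k ∈ s, (2 : ℝ≥0∞) ^ (k * β) * b k *
        ∫⁻ x, (annulus n k).indicator f x * u k m x) atTop
        (𝓝 (∑ k ∈ s, (2 : ℝ≥0∞) ^ (k * β) * b k * N ((annulus n k).indicator f))) :=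
      tendsto_finsetSum _ fun k _ => ENNReal.Tendsto.const_mul (hu k)
        (.inr (ENNReal.mul_ne_top (by finiteness) (hbt k)))
    have hs' : c < ∑ k ∈ s, (2 : ℝ≥0∞) ^ (k * β) * b k * N ((annulus n k).indicator f) := by
      simpa only [mul_right_comm] using hs
    obtain ⟨m, hm⟩ := (hlim.eventually (lt_mem_nhds hs')).exists
    set v : ℤ → Euc n → ℝ≥0∞ := fun k x => if k ∈ s then (2 : ℝ≥0∞) ^ (k * β) * b k * u k m x
      else 0 with hv
    have hvm : ∀ k, Measurable (v k) := fun k => by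
      by_cases hk : k ∈ s
      · simpa [hv, hk] using (hum k m).const_mul _
      · simp [hv, hk]
    have hgm : Measurable fun x => ∑' k, (annulus n k).indicator (v k) x :=
      Measurable.tsum fun k => (hvm k).indicator (measurableSet_annulus k)
    have hgk : ∀ k, (annulus n k).indicator (fun x => ∑' j, (annulus n j).indicator (v j) x) =
        (annulus n k).indicator (v k) := fun k => by
      ext x
      by_cases hx : x ∈ annulus n k
      · rw [indicator_of_mem hx, indicator_of_mem hx, tsum_indicator_annulus _ hx]
      · rw [indicator_of_notMem hx, indicator_of_notMem hx]
    refine ⟨_, hgm, ?_, ?_⟩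
    · rw [herzNorm_eq hP.symm.nonneg]
      refine ENNReal.rpow_le_one (le_trans (ENNReal.tsum_le_tsum fun k => ?_) hb1)
        (one_div_nonneg.2 hP.symm.nonneg)
      refine ENNReal.rpow_le_rpow ?_ hP.symm.nonneg
      rw [hgk]
      by_cases hk : k ∈ s
      · calc (2 : ℝ≥0∞) ^ (k * -β) * N' ((annulus n k).indicator (v k))
            ≤ 2 ^ (k * -β) * N' (fun x => 2 ^ (k * β) * b k * u k m x) := by
              gcongr
              refine h'.mono ((hvm k).indicator (measurableSet_annulus k))
                ((hum k m).const_mul _) fun x => ?_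
              refine (indicator_le_self' (fun _ _ => zero_le) x).trans ?_
              simp [hv, hk]
          _ ≤ 2 ^ (k * -β) * (2 ^ (k * β) * b k * 1) := by
              gcongr
              exact (h'.const_mul_le _ (hum k m)).trans (by gcongr; exact hu1 k m)
          _ = 2 ^ (k * β) * 2 ^ (-(k * β)) * b k := by rw [mul_neg]; ring
          _ = b k := by rw [two_rpow_mul_two_rpow_neg, one_mul]
      · have : (annulus n k).indicator (v k) = fun _ => 0 := by
          ext x
          simp [hv, hk]
        rw [this, h'.zero, mul_zero]
        exact zero_le
    · refine hm.trans_le ?_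
      rw [lintegral_eq_tsum_annulus (hf.fun_mul hgm)]
      refine le_trans (Finset.sum_le_sum fun k hk => ?_) (ENNReal.sum_le_tsum s)
      rw [← lintegral_const_mul _ ((hfk k).fun_mul (hum k m))]
      refine lintegral_mono fun x => ?_
      by_cases hx : x ∈ annulus n k
      · rw [indicator_of_mem hx, indicator_of_mem hx, tsum_indicator_annulus _ hx]
        simp only [hv, hk, if_true]
        exact (mul_left_comm _ _ _).le
      · simp [hx]

end Herz

theorem tsum_convolution_rpow_le {p p' : ℝ} (hp : p.HolderConjugate p') (κ a : ℤ → ℝ≥0∞) :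
    (∑' k, (∑' j, κ (k - j) * a j) ^ p) ^ (1 / p) ≤ (∑' m, κ m) * (∑' k, a k ^ p) ^ (1 / p) := by
  by_contra! hlt
  obtain ⟨b, hb1, hb⟩ := exists_tsum_rpow_le_one_lt_tsum_mul hp hlt
  refine absurd hb (not_lt.2 ?_)
  have hconv : ∀ k, ∑' j, κ (k - j) * a j = ∑' m, κ m * a (k - m) := fun k => by
    rw [← (Equiv.subLeft k).tsum_eq]
    simp
  calc ∑' k, (∑' j, κ (k - j) * a j) * b k = ∑' m, κ m * ∑' k, a (k - m) * b k := by
        simp_rw [hconv, ← ENNReal.tsum_mul_right, ← ENNReal.tsum_mul_left]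
        rw [ENNReal.tsum_comm]
        simp_rw [mul_assoc]
    _ ≤ ∑' m, κ m * (∑' k, a k ^ p) ^ (1 / p) := by
        refine ENNReal.tsum_le_tsum fun m => ?_
        gcongr
        refine (tsum_mul_le_rpow_tsum_mul_rpow_tsum hp _ _).trans ?_
        have hshift : ∑' k, a (k - m) ^ p = ∑' k, a k ^ p :=
          (Equiv.subRight m).tsum_eq fun k => a k ^ p
        rw [hshift]
        exact mul_le_of_le_one_right' (ENNReal.rpow_le_one hb1 (one_div_nonneg.2 hp.symm.nonneg))
    _ = _ := ENNReal.tsum_mul_right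

theorem tsum_two_rpow_neg_mul_abs_ne_top {δ : ℝ} (hδ : 0 < δ) :
    ∑' m : ℤ, (2 : ℝ≥0∞) ^ (-(δ * |(m : ℝ)|)) ≠ ∞ := by
  set t : ℝ≥0∞ := 2 ^ (-δ) with ht
  have ht1 : t < 1 := ENNReal.rpow_lt_one_of_one_lt_of_neg (by norm_num) (by linarith)
  have hS : ∑' k : ℕ, t ^ k ≠ ∞ := by
    rw [ENNReal.tsum_geometric]
    exact ENNReal.inv_ne_top.2 (tsub_pos_of_lt ht1).ne'
  have hpow : ∀ k : ℕ, (2 : ℝ≥0∞) ^ (-(δ * (k : ℝ))) = t ^ k := fun k => by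
    rw [ht, ← ENNReal.rpow_natCast, ← ENNReal.rpow_mul, neg_mul]
  have h1 : ∀ k : ℕ, (2 : ℝ≥0∞) ^ (-(δ * |((k : ℤ) : ℝ)|)) = t ^ k := fun k => by
    rw [← hpow]; simp
  have h2 : ∀ k : ℕ, (2 : ℝ≥0∞) ^ (-(δ * |((-((k : ℤ) + 1) : ℤ) : ℝ)|)) = t ^ (k + 1) :=
    fun k => by
      rw [← hpow, Int.cast_neg, abs_neg, abs_of_nonneg (by positivity)]
      push_cast
      rfl
  have h := HasSum.of_nat_of_neg_add_one
    (f := fun m : ℤ => (2 : ℝ≥0∞) ^ (-(δ * |(m : ℝ)|))) ENNReal.summable.hasSum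
    ENNReal.summable.hasSum
  rw [h.tsum_eq]
  simp_rw [h1, h2]
  refine ENNReal.add_ne_top.2 ⟨hS, ne_top_of_le_ne_top hS (ENNReal.tsum_le_tsum fun k => ?_)⟩
  exact pow_le_pow_right_of_le_one' ht1.le k.le_succ

theorem ofReal_two_zpow (k : ℤ) : ENNReal.ofReal ((2 : ℝ) ^ k) = (2 : ℝ≥0∞) ^ (k : ℝ) := by
  rw [← Real.rpow_intCast, ← ENNReal.ofReal_rpow_of_pos two_pos, ENNReal.ofReal_ofNat]

section HerzMaximal

variable {n : ℕ}

theorem maximalFn_le_of_support_annulus {j k : ℤ} (hjk : 2 ≤ |j - k|) {g : Euc n → ℝ≥0∞}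
    (hg : ∀ y ∉ annulus n j, g y = 0) {x : Euc n} (hx : x ∈ annulus n k) :
    maximalFn g x ≤ (volume (Metric.ball (0 : Euc n) 1))⁻¹ *
      2 ^ ((3 - max (j : ℝ) k) * n) * ∫⁻ y, g y := by
  refine maximalFn_le fun c r hr hxc => ?_
  by_cases hy : ∃ y ∈ Metric.ball c r, y ∈ annulus n j
  · obtain ⟨y, hyc, hyj⟩ := hy
    have hxy : ‖x - y‖ < 2 * r := by
      rw [← dist_eq_norm]
      have h1 := dist_triangle_right x y c
      rw [Metric.mem_ball] at hxc hyc
      linarith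
    have hpow : ∀ m : ℤ, (2 : ℝ) ^ (m - 1) = 2 ^ m / 2 := fun m => by
      rw [zpow_sub_one₀ two_ne_zero, div_eq_mul_inv]
    have hr3 : (2 : ℝ) ^ (max j k - 3) ≤ r := by
      have e : ∀ m : ℤ, (2 : ℝ) ^ (m - 3) = 2 ^ m / 8 := fun m => by
        rw [zpow_sub₀ two_ne_zero]; norm_num
      have e' : ∀ m : ℤ, (2 : ℝ) ^ (m - 2) = 2 ^ m / 4 := fun m => by
        rw [zpow_sub₀ two_ne_zero]; norm_num
      rw [mem_annulus, hpow] at hx hyj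
      rcases le_total j k with h | h
      · rw [max_eq_right h, e]
        rw [abs_of_nonpos (by omega)] at hjk
        have h1 : (2 : ℝ) ^ j ≤ 2 ^ (k - 2) := zpow_le_zpow_right₀ one_le_two (by omega)
        rw [e'] at h1
        have h2 := norm_sub_norm_le x y
        linarith [hx.1, hyj.2]
      · rw [max_eq_left h, e]
        rw [abs_of_nonneg (by omega)] at hjk
        have h1 : (2 : ℝ) ^ k ≤ 2 ^ (j - 2) := zpow_le_zpow_right₀ one_le_two (by omega)
        rw [e'] at h1
        have h2 := norm_sub_norm_le y x
        rw [norm_sub_rev] at h2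
        linarith [hyj.1, hx.2]
    gcongr
    · calc (volume (Metric.ball c r))⁻¹
          ≤ (((2 : ℝ≥0∞) ^ ((max j k - 3 : ℤ) : ℝ)) ^ n *
              volume (Metric.ball (0 : Euc n) 1))⁻¹ := by
            rw [volume_ball_eq c hr, ← ofReal_two_zpow]
            gcongr
        _ = _ := by
            rw [ENNReal.mul_inv (.inl (by positivity)) (.inl (by finiteness)), mul_comm,
              ← ENNReal.rpow_natCast, ← ENNReal.rpow_mul, ← ENNReal.rpow_neg]
            congr 2
            push_cast
            ring
    · exact Measure.restrict_le_self
  · push Not at hy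
    rw [setLIntegral_congr_fun Metric.isOpen_ball.measurableSet fun y hyc => hg y (hy y hyc)]
    simp

theorem mixedNorm_indicator_annulus_le {q : Fin n → ℝ} (hq : ∀ i, 0 < q i) (k : ℤ) (c : ℝ≥0∞) :
    mixedNorm q ((annulus n k).indicator fun _ => c) ≤ c * 2 ^ ((k + 1) * ∑ i, 1 / q i) := by
  have hR : ENNReal.ofReal (2 * (2 : ℝ) ^ k) = (2 : ℝ≥0∞) ^ ((k : ℝ) + 1) := by
    rw [← zpow_one_add₀ two_ne_zero, ofReal_two_zpow]
    push_cast
    rw [add_comm]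
  rw [ENNReal.rpow_mul, ← hR, ← mixedNormAux_box hq, mixedNorm_eq]
  refine mixedNormAux_mono q (fun i => (hq i).le) fun x => ?_
  by_cases hx : MeasurableEquiv.toLp 2 (Fin n → ℝ) x ∈ annulus n k
  · have hx' : x ∈ {x : Fin n → ℝ | ∀ i, x i ∈ Ioo (-(2 : ℝ) ^ k) (2 ^ k)} := fun i => by
      have h1 : ‖x i‖ < 2 ^ k := (PiLp.norm_apply_le
        (MeasurableEquiv.toLp 2 (Fin n → ℝ) x) i).trans_lt (mem_annulus.1 hx).2
      exact abs_lt.1 h1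
    rw [indicator_of_mem hx', Function.comp_apply, indicator_of_mem hx]
  · rw [Function.comp_apply, indicator_of_notMem hx]
    exact zero_le

theorem maximalFn_le_tsum_annulus [NeZero n] {f : Euc n → ℝ≥0∞} (hf : Measurable f) (x : Euc n) :
    maximalFn f x ≤ ∑' j, maximalFn ((annulus n j).indicator f) x := by
  refine maximalFn_le fun c r hr hx => ?_
  rw [lintegral_congr_ae (ae_restrict_of_ae (ae_eq_tsum_indicator_annulus f)),
    lintegral_tsum fun k => (hf.indicator (measurableSet_annulus k)).aemeasurable,
    ← ENNReal.tsum_mul_left]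
  exact ENNReal.tsum_le_tsum fun j => average_le_maximalFn _ hr hx

end HerzMaximal

section HerzMaximalBound

variable {n : ℕ}

theorem sum_one_div_conjExponent {q : Fin n → ℝ} (hq : ∀ i, 1 < q i) :
    ∑ i, 1 / (q i).conjExponent = n - ∑ i, 1 / q i := by
  rw [eq_sub_iff_add_eq, ← Finset.sum_add_distrib]
  simp only [one_div]
  rw [Finset.sum_congr rfl fun i _ =>
    (Real.HolderConjugate.conjExponent (hq i)).symm.inv_add_inv_eq_one]
  simp

theorem one_lt_conjExponent {p : ℝ} (hp : 1 < p) : 1 < p.conjExponent :=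
  (Real.HolderConjugate.conjExponent hp).symm.lt

theorem exists_mixedNorm_indicator_maximalFn_le {q : Fin n → ℝ} (hq : ∀ i, 1 < q i) {D : ℝ}
    (hD : D = ∑ i, 1 / q i) : ∃ C : ℝ≥0∞, C ≠ ∞ ∧ ∀ (j k : ℤ) (g : Euc n → ℝ≥0∞), Measurable g →
      (∀ y ∉ annulus n j, g y = 0) → mixedNorm q ((annulus n k).indicator (maximalFn g)) ≤
        C * 2 ^ (-(max (j : ℝ) k * n) + j * (n - D) + k * D) * mixedNorm q g := by
  obtain ⟨C₀, hC₀, h⟩ := exists_mixedNorm_maximalFn_le hq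
  have hdual := isKotheDual_mixedNorm_conjExponent hq
  set V := volume (Metric.ball (0 : Euc n) 1) with hV
  have hVt : V⁻¹ ≠ ∞ := ENNReal.inv_ne_top.2 (Metric.measure_ball_pos _ _ one_pos).ne'
  have hD0 : 0 ≤ D := hD ▸ Finset.sum_nonneg fun i _ => by
    have := hq i
    positivity
  have hD' : 0 ≤ n - D := by
    rw [hD, ← sum_one_div_conjExponent hq]
    exact Finset.sum_nonneg fun i _ => by
      have := one_lt_conjExponent (hq i)
      positivity
  refine ⟨C₀ * 2 ^ (n : ℝ) + V⁻¹ * 2 ^ (4 * n : ℝ), by finiteness, fun j k g hg hgj => ?_⟩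
  by_cases hjk : 2 ≤ |j - k|
  · have hint : ∫⁻ y, g y ≤ mixedNorm q g * 2 ^ ((j + 1) * (n - D)) := by
      calc ∫⁻ y, g y = ∫⁻ y, g y * (annulus n j).indicator (fun _ => 1) y := by
            refine lintegral_congr fun y => ?_
            by_cases hy : y ∈ annulus n j <;> simp [hy, hgj]
        _ ≤ mixedNorm q g * mixedNorm (fun i => (q i).conjExponent)
              ((annulus n j).indicator fun _ => 1) :=
            hdual.holder _ _ hg (measurable_const.indicator (measurableSet_annulus j))
        _ ≤ _ := by
            gcongr
            refine (mixedNorm_indicator_annulus_le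
              (fun i => zero_lt_one.trans (one_lt_conjExponent (hq i))) j 1).trans ?_
            rw [one_mul, sum_one_div_conjExponent hq, hD]
    set c : ℝ≥0∞ := V⁻¹ * 2 ^ ((3 - max (j : ℝ) k) * n) * ∫⁻ y, g y with hc
    calc mixedNorm q ((annulus n k).indicator (maximalFn g))
        ≤ mixedNorm q ((annulus n k).indicator fun _ => c) := by
          refine hdual.mono ((measurable_maximalFn g).indicator (measurableSet_annulus k))
            (measurable_const.indicator (measurableSet_annulus k)) fun x => ?_
          by_cases hx : x ∈ annulus n k
          · rw [indicator_of_mem hx, indicator_of_mem hx]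
            exact maximalFn_le_of_support_annulus hjk hgj hx
          · simp [hx]
      _ ≤ c * 2 ^ ((k + 1) * D) := by
          rw [hD]
          exact mixedNorm_indicator_annulus_le (fun i => zero_lt_one.trans (hq i)) k c
      _ ≤ V⁻¹ * 2 ^ ((3 - max (j : ℝ) k) * n) * (mixedNorm q g * 2 ^ ((j + 1) * (n - D))) *
            2 ^ ((k + 1) * D) := by
          rw [hc]
          gcongr
      _ = V⁻¹ * (2 ^ ((3 - max (j : ℝ) k) * n) * 2 ^ ((j + 1) * (n - D)) * 2 ^ ((k + 1) * D)) *
            mixedNorm q g := by ring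
      _ = V⁻¹ * (2 ^ (4 * n : ℝ) * 2 ^ (-(max (j : ℝ) k * n) + j * (n - D) + k * D)) *
            mixedNorm q g := by
          simp only [← ENNReal.rpow_add _ _ two_ne_zero ENNReal.ofNat_ne_top]
          congr 3
          ring
      _ ≤ _ := by
          rw [← mul_assoc]
          gcongr
          exact le_add_self
  · have hjk' : j - k = 0 ∨ j - k = 1 ∨ j - k = -1 := by
      rw [not_le, abs_lt] at hjk
      omega
    have hexp : 0 ≤ (n : ℝ) + (-(max (j : ℝ) k * n) + j * (n - D) + k * D) := by
      rcases hjk' with h | h | h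
      · have : (j : ℝ) = k := by exact_mod_cast (sub_eq_zero.1 h)
        rw [this, max_self]
        nlinarith
      · have : (j : ℝ) = k + 1 := by exact_mod_cast (sub_eq_iff_eq_add'.1 h)
        rw [this, max_eq_left (by linarith)]
        nlinarith
      · have : (k : ℝ) = j + 1 := by
          have : k = j + 1 := by omega
          exact_mod_cast this
        rw [this, max_eq_right (by linarith)]
        nlinarith
    calc mixedNorm q ((annulus n k).indicator (maximalFn g)) ≤ mixedNorm q (maximalFn g) :=
          hdual.mono ((measurable_maximalFn g).indicator (measurableSet_annulus k))
            (measurable_maximalFn g) (indicator_le_self' fun _ _ => zero_le)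
      _ ≤ C₀ * mixedNorm q g := h g hg
      _ ≤ C₀ * (2 ^ (n : ℝ) * 2 ^ (-(max (j : ℝ) k * n) + j * (n - D) + k * D)) *
            mixedNorm q g := by
          rw [← ENNReal.rpow_add _ _ two_ne_zero ENNReal.ofNat_ne_top]
          gcongr
          refine le_mul_of_one_le_right' ?_
          simpa using ENNReal.rpow_le_rpow_of_exponent_le one_le_two hexp
      _ ≤ _ := by
          rw [← mul_assoc]
          gcongr
          exact le_self_add

theorem exists_herzNorm_maximalFn_le [NeZero n] {q : Fin n → ℝ} (hq : ∀ i, 1 < q i) {P : ℝ}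
    (hP : 1 < P) {β : ℝ} (hβ : -∑ i, 1 / q i < β) (hβ' : β < n - ∑ i, 1 / q i) :
    ∃ C : ℝ≥0∞, C ≠ ∞ ∧ ∀ f : Euc n → ℝ≥0∞, Measurable f →
      herzNorm (mixedNorm q) β P (maximalFn f) ≤ C * herzNorm (mixedNorm q) β P f := by
  set D := ∑ i, 1 / q i with hD
  obtain ⟨C, hC, h⟩ := exists_mixedNorm_indicator_maximalFn_le hq hD
  set δ := min (n - D - β) (D + β) with hδ
  have hδ0 : 0 < δ := lt_min (by linarith) (by linarith)
  set κ : ℤ → ℝ≥0∞ := fun m => C * 2 ^ (-(δ * |(m : ℝ)|)) with hκ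
  have hκt : ∑' m, κ m ≠ ∞ := by
    rw [ENNReal.tsum_mul_left]
    exact ENNReal.mul_ne_top hC (tsum_two_rpow_neg_mul_abs_ne_top hδ0)
  have hP' : P.HolderConjugate P.conjExponent := Real.HolderConjugate.conjExponent hP
  refine ⟨_, hκt, fun f hf => ?_⟩
  rw [herzNorm_eq hP'.nonneg, herzNorm_eq hP'.nonneg]
  refine le_trans ?_ (tsum_convolution_rpow_le hP' κ _)
  refine ENNReal.rpow_le_rpow (ENNReal.tsum_le_tsum fun k => ?_) (one_div_nonneg.2 hP'.nonneg)
  refine ENNReal.rpow_le_rpow ?_ hP'.nonneg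
  have hfm : ∀ j, Measurable ((annulus n j).indicator f) := fun j =>
    hf.indicator (measurableSet_annulus j)
  have hMm : ∀ j, Measurable ((annulus n k).indicator (maximalFn ((annulus n j).indicator f))) :=
    fun j => (measurable_maximalFn _).indicator (measurableSet_annulus k)
  have hsum : mixedNorm q ((annulus n k).indicator (maximalFn f)) ≤
      ∑' j, mixedNorm q ((annulus n k).indicator (maximalFn ((annulus n j).indicator f))) := by
    refine ((isKotheDual_mixedNorm_conjExponent hq).mono ((measurable_maximalFn f).indicator
      (measurableSet_annulus k)) (Measurable.tsum hMm) fun x => ?_).trans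
      ((isKotheDual_mixedNorm_conjExponent hq).tsum_le hMm)
    by_cases hx : x ∈ annulus n k
    · simpa only [indicator_of_mem hx] using maximalFn_le_tsum_annulus hf x
    · simp [hx]
  refine (mul_le_mul_right hsum _).trans ?_
  rw [← ENNReal.tsum_mul_left]
  refine ENNReal.tsum_le_tsum fun j => ?_
  have hexp : k * β + (-(max (j : ℝ) k * n) + j * (n - D) + k * D) ≤
      -(δ * |((k - j : ℤ) : ℝ)|) + j * β := by
    push_cast
    rcases le_total (j : ℝ) k with hjk | hjk
    · rw [max_eq_right hjk, abs_of_nonneg (sub_nonneg.2 hjk)]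
      nlinarith [min_le_left (n - D - β) (D + β)]
    · rw [max_eq_left hjk, abs_of_nonpos (sub_nonpos.2 hjk)]
      nlinarith [min_le_right (n - D - β) (D + β)]
  calc (2 : ℝ≥0∞) ^ (k * β) *
        mixedNorm q ((annulus n k).indicator (maximalFn ((annulus n j).indicator f)))
      ≤ 2 ^ (k * β) * (C * 2 ^ (-(max (j : ℝ) k * n) + j * (n - D) + k * D) *
          mixedNorm q ((annulus n j).indicator f)) := by
        gcongr
        exact h j k _ (hfm j) fun y hy => indicator_of_notMem hy _
    _ = C * 2 ^ (k * β + (-(max (j : ℝ) k * n) + j * (n - D) + k * D)) *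
          mixedNorm q ((annulus n j).indicator f) := by
        rw [ENNReal.rpow_add (k * β) _ two_ne_zero ENNReal.ofNat_ne_top]
        ring
    _ ≤ C * 2 ^ (-(δ * |((k - j : ℤ) : ℝ)|) + j * β) * mixedNorm q ((annulus n j).indicator f) := by
        gcongr
        exact one_le_two
    _ = _ := by
        rw [hκ, ENNReal.rpow_add _ _ two_ne_zero ENNReal.ofNat_ne_top]
        ring

end HerzMaximalBound

section HerzExtrapolation

variable {n : ℕ}

theorem exists_pos_herzNorm_mixedNorm_le_one [NeZero n] {q : Fin n → ℝ} (hq : ∀ i, 1 < q i)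
    {P : ℝ} (hP : 1 < P) (β : ℝ) :
    ∃ φ : Euc n → ℝ≥0∞, Measurable φ ∧ (∀ x, 0 < φ x) ∧ herzNorm (mixedNorm q) β P φ ≤ 1 := by
  have hP' : P.HolderConjugate P.conjExponent := Real.HolderConjugate.conjExponent hP
  refine ((isKotheDual_mixedNorm_conjExponent hq).herzNorm
    (isKotheDual_mixedNorm_conjExponent_left hq) hP' β).exists_pos
    (E := fun k : ℤ => insert 0 (annulus n k)) (fun k => (measurableSet_annulus k).insert 0)
    (fun x => ?_) fun k => ?_
  · rcases eq_or_ne x 0 with rfl | hx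
    · exact ⟨0, mem_insert _ _⟩
    · obtain ⟨k, hk⟩ := exists_mem_annulus hx
      exact ⟨k, mem_insert_of_mem _ hk⟩
  · have h0 : ∀ j, (0 : Euc n) ∉ annulus n j := fun j hj => by
      rw [mem_annulus, norm_zero] at hj
      exact absurd hj.1 (not_le.2 (by positivity))
    have hind : ∀ j, (annulus n j).indicator ((insert 0 (annulus n k)).indicator 1) =
        if j = k then (annulus n k).indicator fun _ => (1 : ℝ≥0∞) else fun _ => 0 := fun j => by
      ext x
      by_cases hx : x ∈ annulus n j
      · have hx0 : x ≠ 0 := fun h => h0 j (h ▸ hx)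
        split_ifs with hjk
        · subst hjk
          simp [hx]
        · have : x ∉ annulus n k := fun h => hjk (eq_of_mem_annulus hx h)
          simp [hx, this, hx0]
      · split_ifs with hjk
        · subst hjk
          simp [hx]
        · simp [hx]
    rw [herzNorm_eq hP'.nonneg]
    refine ENNReal.rpow_ne_top_of_nonneg (one_div_nonneg.2 hP'.nonneg) ?_
    rw [tsum_eq_single k fun j hj => by
      rw [hind, if_neg hj, (isKotheDual_mixedNorm_conjExponent hq).zero, mul_zero,
        ENNReal.zero_rpow_of_pos hP'.pos], hind, if_pos rfl]
    refine ENNReal.rpow_ne_top_of_nonneg hP'.nonneg (ENNReal.mul_ne_top (by finiteness) ?_)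
    refine ne_top_of_le_ne_top ?_
      (mixedNorm_indicator_annulus_le (fun i => zero_lt_one.trans (hq i)) k 1)
    finiteness

theorem herzNorm_mixedNorm_rpow {s p : ℝ} (hs : 0 < s) (hp : 0 < p) (q : Fin n → ℝ) (α : ℝ)
    (f : Euc n → ℝ≥0∞) :
    herzNorm (mixedNorm fun i => q i / s) (α * s) (p / s) (fun x => f x ^ s) =
      herzNorm (mixedNorm q) α p f ^ s := by
  have hN : ∀ k, mixedNorm (fun i => q i / s) ((annulus n k).indicator fun x => f x ^ s) =
      mixedNorm q ((annulus n k).indicator f) ^ s := fun k => by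
    have e : ((annulus n k).indicator fun x => f x ^ s) =
        fun x => (annulus n k).indicator f x ^ s := by
      ext x
      by_cases hx : x ∈ annulus n k <;> simp [hx, hs]
    rw [e]
    exact mixedNormAux_rpow hs q _
  simp only [herzNorm, hN]
  rw [← ENNReal.rpow_mul]
  congr 1
  · refine tsum_congr fun k => ?_
    rw [← ENNReal.rpow_mul]
    congr 2 <;> field_simp
  · field_simp

/-- The Rubio de Francia algorithm for the Hardy–Littlewood maximal operator produces
`A₁` weights. -/
theorem IsKotheDual.exists_isA1 [NeZero n] {N N' : (Euc n → ℝ≥0∞) → ℝ≥0∞}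
    (h : IsKotheDual volume N N') {A : ℝ≥0∞} (hA0 : A ≠ 0) (hA : A ≠ ∞)
    (hMN : ∀ f, Measurable f → N (maximalFn f) ≤ A * N f)
    {φ φ' : Euc n → ℝ≥0∞} (hφ : Measurable φ) (hφ0 : ∀ x, 0 < φ x) (hφN : N φ ≤ 1)
    (hφ' : Measurable φ') (hφ'0 : ∀ x, 0 < φ' x) (hφ'N : N' φ' ≤ 1)
    {g : Euc n → ℝ≥0∞} (hg : Measurable g) (hgN : N g ≤ 1) :
    ∃ w, IsA1 (2 * A) w ∧ (∀ x, g x ≤ w x) ∧ N w ≤ 4 := by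
  have hM := isSublinear_maximalFn (n := n)
  have hgφ : Measurable fun x => g x + φ x := hg.fun_add hφ
  set w := rubioDeFrancia maximalFn A fun x => g x + φ x with hw
  have hwm : Measurable w := hM.measurable_rubioDeFrancia hgφ
  have hNw : N w ≤ 4 := by
    refine (hM.norm_rubioDeFrancia_le h hA0 hA hMN hgφ).trans ?_
    calc 2 * N (fun x => g x + φ x) ≤ 2 * (1 + 1) := by
          gcongr
          exact (h.add_le hg hφ).trans (add_le_add hgN hφN)
      _ = 4 := by norm_num
  have hwt : ∀ᵐ x, w x < ∞ := h.ae_lt_top hwm hφ' hφ'0 (ne_top_of_le_ne_top one_ne_top hφ'N)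
    (ne_top_of_le_ne_top ENNReal.ofNat_ne_top hNw)
  have hMw : ∀ x, maximalFn w x ≤ 2 * A * w x := hM.apply_rubioDeFrancia_le hA0 hA hgφ
  refine ⟨w, ⟨hwm, ?_, fun x r hr => ?_, Eventually.of_forall hMw⟩, fun x =>
    le_self_add.trans (le_rubioDeFrancia maximalFn A _ x), hNw⟩
  · filter_upwards [hwt] with x hx
    exact ⟨(hφ0 x).trans_le (le_add_self.trans (le_rubioDeFrancia maximalFn A _ x)), hx⟩
  · obtain ⟨y, hy⟩ := hwt.exists
    set R := r + dist y x with hR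
    have hR0 : 0 < R := by positivity
    have hyR : y ∈ Metric.ball x R := by
      rw [Metric.mem_ball]
      linarith
    have hav := (average_le_maximalFn w hR0 hyR).trans (hMw y)
    have hrR : r ≤ R := le_add_of_nonneg_right dist_nonneg
    refine (lintegral_mono_set (Metric.ball_subset_ball hrR)).trans_lt ?_
    rw [ENNReal.inv_mul_le_iff (Metric.measure_ball_pos _ _ hR0).ne' measure_ball_lt_top.ne] at hav
    refine hav.trans_lt ?_
    finiteness [hy.ne, measure_ball_lt_top (μ := (volume : Measure (Euc n))) (x := x) (r := R)]

theorem wLpNorm_rpow {s : ℝ} (hs : 0 < s) (w : Euc n → ℝ≥0∞) (f : Euc n → ℝ) :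
    wLpNorm s w f ^ s = ∫⁻ x, (‖f x‖₊ : ℝ≥0∞) ^ s * w x := by
  rw [wLpNorm, ← ENNReal.rpow_mul, one_div_mul_cancel hs.ne', ENNReal.rpow_one]

end HerzExtrapolation

/-- extrapolation on mixed Herz spaces. Let `n ≥ 2`, `0 < s < p < ∞`,
`s < q_i < ∞` with `−Σ 1/q_i < α < n/s − Σ 1/q_i`. If `T` satisfies
`‖Tf‖_{L^s_w} ≤ C([w]_{A₁})‖f‖_{L^s_w}` for all `w ∈ A₁`, then `T` is bounded on
`K̇^{α,p}_{q⃗}(ℝⁿ)`. -/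
theorem stmt16 {n : ℕ} (hn : 2 ≤ n) (α p s : ℝ) (hs : 0 < s) (hsp : s < p)
    (q : Fin n → ℝ) (hq : ∀ i, s < q i)
    (hα : -(∑ i, 1 / q i) < α ∧ α < (n : ℝ) / s - ∑ i, 1 / q i)
    (T : (Euc n → ℝ) → Euc n → ℝ)
    (hTmeas : ∀ f : Euc n → ℝ, Measurable f → Measurable (T f))
    (hT : ∀ Λ : ℝ≥0∞, 1 ≤ Λ → Λ ≠ ∞ → ∃ CΛ : ℝ≥0∞, CΛ < ∞ ∧
      ∀ w : Euc n → ℝ≥0∞, IsA1 Λ w → ∀ f : Euc n → ℝ, Measurable f →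
        wLpNorm s w f < ∞ → wLpNorm s w (T f) ≤ CΛ * wLpNorm s w f) :
    ∃ C' : ℝ≥0∞, 0 < C' ∧ C' < ∞ ∧
      ∀ f : Euc n → ℝ, Measurable f → herzR (mixedNorm q) α p f ≠ ∞ →
        herzR (mixedNorm q) α p (T f) ≤ C' * herzR (mixedNorm q) α p f := by
  have : NeZero n := ⟨by omega⟩
  have hp : 0 < p := hs.trans hsp
  have hq0 : ∀ i, 0 < q i := fun i => hs.trans (hq i)
  set r : Fin n → ℝ := fun i => q i / s with hr
  have hr1 : ∀ i, 1 < r i := fun i => (one_lt_div hs).2 (hq i)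
  have hr1' : ∀ i, 1 < (r i).conjExponent := fun i => one_lt_conjExponent (hr1 i)
  have hP1 : 1 < p / s := (one_lt_div hs).2 hsp
  have hP : (p / s).HolderConjugate (p / s).conjExponent := Real.HolderConjugate.conjExponent hP1
  have hsum : ∑ i, 1 / r i = s * ∑ i, 1 / q i := by
    rw [Finset.mul_sum]
    refine Finset.sum_congr rfl fun i _ => ?_
    rw [hr, one_div_div, mul_one_div]
  have hα1 : -(s * ∑ i, 1 / q i) < α * s := by nlinarith [hα.1]
  have hα2 : α * s < n - s * ∑ i, 1 / q i := by
    have h1 := mul_lt_mul_of_pos_right hα.2 hs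
    rw [sub_mul, div_mul_cancel₀ _ hs.ne'] at h1
    linarith
  have hK := (isKotheDual_mixedNorm_conjExponent hr1).herzNorm
    (isKotheDual_mixedNorm_conjExponent_left hr1) hP (α * s)
  have hK' := (isKotheDual_mixedNorm_conjExponent_left hr1).herzNorm
    (isKotheDual_mixedNorm_conjExponent hr1) hP.symm (-(α * s))
  rw [neg_neg] at hK'
  obtain ⟨φ, hφ, hφ0, hφN⟩ := exists_pos_herzNorm_mixedNorm_le_one hr1' hP.symm.lt (-(α * s))
  obtain ⟨φ', hφ', hφ'0, hφ'N⟩ := exists_pos_herzNorm_mixedNorm_le_one hr1 hP1 (α * s)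
  obtain ⟨A, hA, hMA⟩ := exists_herzNorm_maximalFn_le hr1' hP.symm.lt (β := -(α * s))
    (by rw [sum_one_div_conjExponent hr1, hsum]; linarith)
    (by rw [sum_one_div_conjExponent hr1, hsum]; linarith)
  obtain ⟨C, hC, hTC⟩ := hT (2 * (A + 1)) (by
    rw [mul_add, mul_one]
    exact one_le_two.trans le_add_self) (by finiteness)
  have hB : (C ^ s * 4) ^ (1 / s) ≠ ∞ := by
    refine ENNReal.rpow_ne_top_of_nonneg (by positivity) (ENNReal.mul_ne_top ?_ (by finiteness))
    exact ENNReal.rpow_ne_top_of_nonneg hs.le hC.ne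
  refine ⟨(C ^ s * 4) ^ (1 / s) + 1, by positivity, by finiteness, fun f hf hft => ?_⟩
  have hFN := herzNorm_mixedNorm_rpow hs hp q α fun x => (‖f x‖₊ : ℝ≥0∞)
  have hTFN := herzNorm_mixedNorm_rpow hs hp q α fun x => (‖T f x‖₊ : ℝ≥0∞)
  have hFm : Measurable fun x => (‖f x‖₊ : ℝ≥0∞) ^ s := by fun_prop
  have hTFm : Measurable fun x => (‖T f x‖₊ : ℝ≥0∞) ^ s := by
    have := hTmeas f hf
    fun_prop
  have key : herzR (mixedNorm q) α p (T f) ^ s ≤ C ^ s * 4 * herzR (mixedNorm q) α p f ^ s := by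
    rw [herzR, herzR, ← hFN, ← hTFN]
    refine hK.le_of_forall_lintegral_le hTFm fun g hg hgN => ?_
    obtain ⟨w, hw, hgw, hwN⟩ := hK'.exists_isA1 (A := A + 1) (by simp) (by finiteness)
      (fun u hu => (hMA u hu).trans (by gcongr; exact le_self_add)) hφ hφ0 hφN hφ' hφ'0 hφ'N hg hgN
    have hfw := (hK.holder _ w hFm hw.1).trans (mul_le_mul_right hwN _)
    have hwt : wLpNorm s w f < ∞ := by
      refine ENNReal.rpow_lt_top_of_nonneg (by positivity) (ne_top_of_le_ne_top ?_ hfw)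
      rw [hFN]
      exact ENNReal.mul_ne_top (ENNReal.rpow_ne_top_of_nonneg hs.le hft) (by finiteness)
    calc ∫⁻ x, (‖T f x‖₊ : ℝ≥0∞) ^ s * g x ≤ ∫⁻ x, (‖T f x‖₊ : ℝ≥0∞) ^ s * w x := by
          gcongr with x
          exact hgw x
      _ = wLpNorm s w (T f) ^ s := (wLpNorm_rpow hs w _).symm
      _ ≤ (C * wLpNorm s w f) ^ s := by
          gcongr
          exact hTC w hw f hf hwt
      _ = C ^ s * ∫⁻ x, (‖f x‖₊ : ℝ≥0∞) ^ s * w x := by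
          rw [ENNReal.mul_rpow_of_nonneg _ _ hs.le, wLpNorm_rpow hs]
      _ ≤ C ^ s * (_ * 4) := mul_le_mul_right hfw _
      _ = _ := by rw [mul_comm _ (4 : ℝ≥0∞), mul_assoc]
  have h1 := ENNReal.rpow_le_rpow key (one_div_nonneg.2 hs.le)
  rw [ENNReal.mul_rpow_of_nonneg _ _ (one_div_nonneg.2 hs.le), ← ENNReal.rpow_mul,
    ← ENNReal.rpow_mul, mul_one_div_cancel hs.ne', ENNReal.rpow_one, ENNReal.rpow_one] at h1
  refine h1.trans ?_
  gcongr
  exact le_self_add
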